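/- arXiv:1312.4096 — 7 statements merged into one kernel-verified Lean document; each statement's English description precedes it below -/
import Mathlib

section
/- For any integer n ≥ 2, the number of labeled trees on n vertices is exactly n^(n-2); that is, the number of simple graphs G on the vertex set Fin n such that G is a tree (connected and acyclic) equals n^(n-2). -/
open Finset

namespace SimpleGraph

variable {U S V W : Type*}

/-- `v` is a leaf of `G` if it has exactly one neighbor. -/
def IsLeaf (G : SimpleGraph V) (v : V) : Prop := ∃! w, G.Adj v w

/-- The graph obtained from `H` by attaching each `s : S` as a pendant vertex at `f s`. -/
def attachLeaves (H : SimpleGraph U) (f : S → U) : SimpleGraph (U ⊕ S) where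
  Adj
    | .inl a, .inl b => H.Adj a b
    | .inl a, .inr s => f s = a
    | .inr s, .inl a => f s = a
    | .inr _, .inr _ => False
  symm := ⟨by rintro (a | s) (b | t) <;> simp [H.adj_comm]⟩
  loopless := ⟨by rintro (a | s) <;> simp⟩

section attachLeaves

variable {H H' : SimpleGraph U} {f f' : S → U} {a b : U} {s t : S}

@[simp] lemma attachLeaves_adj_inl_inl :
    (H.attachLeaves f).Adj (.inl a) (.inl b) ↔ H.Adj a b := Iff.rfl

@[simp] lemma attachLeaves_adj_inl_inr :
    (H.attachLeaves f).Adj (.inl a) (.inr s) ↔ f s = a := Iff.rfl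

@[simp] lemma attachLeaves_adj_inr_inl :
    (H.attachLeaves f).Adj (.inr s) (.inl a) ↔ f s = a := Iff.rfl

@[simp] lemma attachLeaves_adj_inr_inr :
    ¬ (H.attachLeaves f).Adj (.inr s) (.inr t) := id

lemma isLeaf_attachLeaves (H : SimpleGraph U) (f : S → U) (s : S) :
    (H.attachLeaves f).IsLeaf (.inr s) :=
  ⟨.inl (f s), by simp, by rintro (a | t) <;> simp [eq_comm]⟩

lemma attachLeaves_le_attachLeaves_iff :
    H.attachLeaves f ≤ H'.attachLeaves f ↔ H ≤ H' := by
  refine ⟨fun h a b hab ↦ @h (.inl a) (.inl b) hab, fun h ↦ ?_⟩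
  rintro (a | s) (b | t) hab
  · exact h hab
  all_goals exact hab

lemma attachLeaves_inj : H.attachLeaves f = H'.attachLeaves f' ↔ H = H' ∧ f = f' := by
  refine ⟨fun h ↦ ⟨?_, ?_⟩, by rintro ⟨rfl, rfl⟩; rfl⟩
  · ext a b
    rw [← attachLeaves_adj_inl_inl (f := f), h, attachLeaves_adj_inl_inl]
  · ext s
    have : (H.attachLeaves f).Adj (.inr s) (.inl (f s)) := by simp
    rw [h, attachLeaves_adj_inr_inl] at this
    exact this.symm

lemma connected_attachLeaves_iff : (H.attachLeaves f).Connected ↔ H.Connected := by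
  constructor
  · intro h
    have key (x y : U ⊕ S) (hxy : (H.attachLeaves f).Reachable x y) :
        H.Reachable (x.elim id f) (y.elim id f) := by
      rw [reachable_iff_reflTransGen] at hxy
      induction hxy with
      | refl => rfl
      | @tail y z _ hyz ih =>
        refine ih.trans ?_
        rcases y with a | s <;> rcases z with b | t <;> simp at hyz <;> simp [hyz]
        exact hyz.reachable
    obtain ⟨x⟩ := h.nonempty
    have : Nonempty U := ⟨x.elim id f⟩
    exact ⟨fun a b ↦ key (.inl a) (.inl b) (h.preconnected _ _)⟩
  · intro h
    obtain ⟨u⟩ := h.nonempty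
    have hl (a : U) : (H.attachLeaves f).Reachable (.inl u) (.inl a) :=
      (h.preconnected u a).map (⟨Sum.inl, id⟩ : H →g H.attachLeaves f)
    refine (connected_iff_exists_forall_reachable _).2 ⟨.inl u, ?_⟩
    rintro (a | s)
    · exact hl a
    · refine (hl (f s)).trans (Adj.reachable ?_)
      simp

lemma exists_eq_attachLeaves {G : SimpleGraph (U ⊕ S)} (hG : ∀ s, ∃ a, ∀ w,
    G.Adj (.inr s) w ↔ w = .inl a) : ∃ (H : SimpleGraph U) (f : S → U), G = H.attachLeaves f := by
  choose f hf using hG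
  refine ⟨G.comap Sum.inl, f, ?_⟩
  ext x y
  rcases x with a | s <;> rcases y with b | t
  · simp
  · simp [G.adj_comm (.inl a), hf, eq_comm]
  · simp [hf, eq_comm]
  · simp [hf]

lemma Connected.exists_eq_attachLeaves_of_le {G : SimpleGraph (U ⊕ S)} (hG : G.Connected)
    (hle : G ≤ H.attachLeaves f) : ∃ H' : SimpleGraph U, G = H'.attachLeaves f := by
  have hadj (s : S) (w : U ⊕ S) : G.Adj (.inr s) w ↔ w = .inl (f s) := by
    have h1 (w : U ⊕ S) (hw : G.Adj (.inr s) w) : w = .inl (f s) := by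
      have := hle hw
      rcases w with a | t <;> simp_all
    refine ⟨h1 w, ?_⟩
    rintro rfl
    have : Nontrivial (U ⊕ S) := ⟨.inl (f s), .inr s, by simp⟩
    obtain ⟨w, hw⟩ := hG.preconnected.exists_adj_of_nontrivial (.inr s)
    rwa [h1 w hw] at hw
  obtain ⟨H', f', rfl⟩ := exists_eq_attachLeaves fun s ↦ ⟨f s, hadj s⟩
  obtain rfl : f = f' := by
    ext s
    have : (H'.attachLeaves f').Adj (.inr s) (.inl (f' s)) := by simp
    simpa [eq_comm] using (hadj s _).1 this
  exact ⟨H', rfl⟩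

lemma isTree_attachLeaves_iff : (H.attachLeaves f).IsTree ↔ H.IsTree := by
  simp only [isTree_iff_minimal_connected, Minimal, connected_attachLeaves_iff]
  refine and_congr_right fun _ ↦ ⟨fun h H' hc hle ↦ ?_, fun h G hc hle ↦ ?_⟩
  · exact attachLeaves_le_attachLeaves_iff.1
      (h (connected_attachLeaves_iff.2 hc) (attachLeaves_le_attachLeaves_iff.2 hle))
  · obtain ⟨H', rfl⟩ := hc.exists_eq_attachLeaves_of_le hle
    exact attachLeaves_le_attachLeaves_iff.2
      (h (connected_attachLeaves_iff.1 hc) (attachLeaves_le_attachLeaves_iff.1 hle))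

end attachLeaves

lemma Preconnected.eq_or_eq_of_adj_of_isLeaf {G : SimpleGraph V} (hG : G.Preconnected) {s t : V}
    (hst : G.Adj s t) (hs : G.IsLeaf s) (ht : G.IsLeaf t) (v : V) : v = s ∨ v = t := by
  have h := hG s v
  rw [reachable_iff_reflTransGen] at h
  induction h with
  | refl => exact .inl rfl
  | tail _ hyz ih =>
    rcases ih with rfl | rfl
    · exact .inr (hs.unique hyz hst)
    · exact .inl (ht.unique hyz hst.symm)

lemma card_isTree_isLeaf_inr (U S : Type*) [Finite S] [Nonempty U] :
    Nat.card {G : SimpleGraph (U ⊕ S) // G.IsTree ∧ ∀ s, G.IsLeaf (.inr s)} =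
      Nat.card {H : SimpleGraph U // H.IsTree} * Nat.card U ^ Nat.card S := by
  rw [← Nat.card_fun, ← Nat.card_prod]
  symm
  refine Nat.card_congr (Equiv.ofBijective (fun p ↦ ⟨attachLeaves p.1.1 p.2,
    isTree_attachLeaves_iff.2 p.1.2, isLeaf_attachLeaves _ _⟩) ⟨?_, ?_⟩)
  · rintro ⟨⟨H, hH⟩, f⟩ ⟨⟨H', hH'⟩, f'⟩ h
    simpa [attachLeaves_inj] using h
  · rintro ⟨G, hG, hl⟩
    obtain ⟨u⟩ := ‹Nonempty U›
    have (s : S) : ∃ a, ∀ w, G.Adj (.inr s) w ↔ w = .inl a := by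
      obtain ⟨w, hw, huniq⟩ := hl s
      rcases w with a | t
      · exact ⟨a, fun w ↦ ⟨huniq w, by rintro rfl; exact hw⟩⟩
      · simpa using hG.preconnected.eq_or_eq_of_adj_of_isLeaf hw (hl s) (hl t) (.inl u)
    obtain ⟨H, f, rfl⟩ := exists_eq_attachLeaves this
    exact ⟨⟨⟨H, isTree_attachLeaves_iff.1 hG⟩, f⟩, rfl⟩

lemma isTree_simpleGraph_iff (e : V ≃ W) (G : SimpleGraph V) :
    (e.simpleGraph G).IsTree ↔ G.IsTree :=
  (Iso.comap e.symm G).isTree_iff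

lemma isLeaf_simpleGraph_iff (e : V ≃ W) (G : SimpleGraph V) (w : W) :
    (e.simpleGraph G).IsLeaf w ↔ G.IsLeaf (e.symm w) :=
  e.symm.existsUnique_congr fun _ ↦ Iff.rfl

lemma card_isTree_congr (e : V ≃ W) :
    Nat.card {G : SimpleGraph V // G.IsTree} = Nat.card {G : SimpleGraph W // G.IsTree} :=
  Nat.card_congr (e.simpleGraph.subtypeEquiv fun G ↦ (isTree_simpleGraph_iff e G).symm)

lemma card_isTree_isLeaf_of_mem {n : ℕ} {t : Finset (Fin n)} (ht : #t < n) :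
    Nat.card {G : SimpleGraph (Fin n) // G.IsTree ∧ ∀ v ∈ t, G.IsLeaf v} =
      Nat.card {G : SimpleGraph (Fin (n - #t)) // G.IsTree} * (n - #t) ^ #t := by
  let e : {v // v ∉ t} ⊕ t ≃ Fin n := (Equiv.sumComm _ _).trans (Equiv.sumCompl (· ∈ t))
  have hU : Fintype.card {v // v ∉ t} = n - #t := by
    simp [Fintype.card_subtype_compl]
  have : Nonempty {v // v ∉ t} := Fintype.card_pos_iff.1 (by omega)
  have h := card_isTree_isLeaf_inr {v // v ∉ t} t
  rw [card_isTree_congr (Fintype.equivFinOfCardEq hU), Nat.card_eq_fintype_card (α := {v // v ∉ t}),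
    hU, Nat.card_eq_fintype_card (α := t), Fintype.card_coe] at h
  rw [← h]
  refine (Nat.card_congr (e.simpleGraph.subtypeEquiv fun G ↦ ?_)).symm
  rw [isTree_simpleGraph_iff]
  simp only [isLeaf_simpleGraph_iff]
  refine and_congr_right fun _ ↦ ⟨fun h v hv ↦ ?_, fun h s ↦ ?_⟩
  · rw [show e.symm v = .inr ⟨v, hv⟩ by rw [Equiv.symm_apply_eq]; rfl]
    exact h _
  · simpa [show e.symm s = .inr s by rw [Equiv.symm_apply_eq]; rfl] using h s s.2

lemma IsTree.exists_isLeaf [Finite V] [Nontrivial V] {G : SimpleGraph V} (hG : G.IsTree) :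
    ∃ v, G.IsLeaf v := by
  classical
  have := Fintype.ofFinite V
  obtain ⟨v, hv⟩ := hG.exists_vert_degree_one_of_nontrivial
  exact ⟨v, degree_eq_one_iff_existsUnique_adj.1 hv⟩

lemma Connected.exists_not_isLeaf {G : SimpleGraph V} (hG : G.Connected) (hV : 2 < ENat.card V) :
    ∃ v, ¬ G.IsLeaf v := by
  by_contra! h
  obtain ⟨s⟩ := hG.nonempty
  obtain ⟨t, hst, -⟩ := h s
  have hsub : (Set.univ : Set V) ⊆ {s, t} := fun v _ ↦
    hG.preconnected.eq_or_eq_of_adj_of_isLeaf hst (h s) (h t) v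
  have := (Set.encard_le_encard hsub).trans (Set.encard_insert_le {t} s)
  rw [Set.encard_univ, Set.encard_singleton, one_add_one_eq_two] at this
  exact absurd hV this.not_gt

/-- Inclusion-exclusion over the set of leaves, using that every tree has a leaf. -/
lemma sum_neg_one_pow_mul_card_isTree_isLeaf {n : ℕ} (hn : 2 ≤ n) :
    ∑ t : Finset (Fin n), (-1 : ℤ) ^ #t *
      Nat.card {G : SimpleGraph (Fin n) // G.IsTree ∧ ∀ v ∈ t, G.IsLeaf v} = 0 := by
  classical
  have : Nontrivial (Fin n) := Fin.nontrivial_iff_two_le.2 hn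
  have h := inclusion_exclusion_card_inf_compl (univ : Finset (Fin n)) fun v ↦
    (univ : Finset {G : SimpleGraph (Fin n) // G.IsTree}).filter fun G ↦ G.1.IsLeaf v
  rw [powerset_univ, Finset.card_eq_zero.2 ?_] at h
  · rw [Nat.cast_zero] at h
    rw [h]
    refine sum_congr rfl fun t _ ↦ ?_
    rw [← Nat.card_congr (Equiv.subtypeSubtypeEquivSubtypeInter _ _),
      Nat.card_eq_fintype_card, Fintype.card_subtype]
    congr 3
    ext G
    simp [mem_inf]
  · ext G
    obtain ⟨v, hv⟩ := G.2.exists_isLeaf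
    simp only [notMem_empty, iff_false, mem_inf, not_forall]
    exact ⟨v, mem_univ _, by simpa using hv⟩

lemma card_isTree_isLeaf_eq_zero {n : ℕ} (hn : 2 < n) :
    Nat.card {G : SimpleGraph (Fin n) // G.IsTree ∧ ∀ v, G.IsLeaf v} = 0 := by
  have : IsEmpty {G : SimpleGraph (Fin n) // G.IsTree ∧ ∀ v, G.IsLeaf v} := by
    refine ⟨fun ⟨G, hG, h⟩ ↦ ?_⟩
    obtain ⟨v, hv⟩ := hG.connected.exists_not_isLeaf (by simpa using mod_cast hn)
    exact hv (h v)
  exact Nat.card_of_isEmpty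

lemma card_isTree_of_le_two {n : ℕ} (h0 : n ≠ 0) (h2 : n ≤ 2) :
    Nat.card {G : SimpleGraph (Fin n) // G.IsTree} = 1 := by
  have : Nonempty (Fin n) := ⟨⟨0, by omega⟩⟩
  have htop {G : SimpleGraph (Fin n)} (hG : G.Connected) : G = ⊤ := by
    refine eq_top_iff.2 fun a b hab ↦ ?_
    have : Nontrivial (Fin n) := ⟨a, b, hab.ne⟩
    obtain ⟨c, hc⟩ := hG.preconnected.exists_adj_of_nontrivial a
    have := hc.ne
    have := hab.ne
    rwa [show b = c by omega]
  refine Nat.card_eq_one_iff_unique.2 ⟨⟨fun G G' ↦ Subtype.ext ?_⟩,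
    ⟨⊤, connected_top, .of_card_le_two (by simpa using mod_cast h2)⟩⟩
  rw [htop G.2.connected, htop G'.2.connected]

end SimpleGraph

lemma sum_neg_one_pow_mul_choose_mul_sub_pow {j n : ℕ} (h : j < n) :
    ∑ k ∈ range (n + 1), (-1 : ℤ) ^ k * n.choose k * ((n - k : ℕ) : ℤ) ^ j = 0 := by
  have := congrFun (fwdDiff_iter_pow_eq_zero_of_lt (R := ℤ) h) 0
  rw [fwdDiff_iter_eq_sum_shift, ← sum_range_reflect] at this
  refine Eq.trans (sum_congr rfl fun k hk ↦ ?_) this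
  have hk : k ≤ n := by simpa [Nat.lt_succ_iff] using hk
  simp [Nat.sub_sub_self hk, Nat.choose_symm hk]

/-- The recurrence for the number of trees obtained by removing a set of leaves. -/
lemma SimpleGraph.sum_neg_one_pow_mul_choose_mul_card_isTree {n : ℕ} (hn : 2 < n) :
    ∑ k ∈ range n, (-1 : ℤ) ^ k * n.choose k *
      (Nat.card {G : SimpleGraph (Fin (n - k)) // G.IsTree} * (n - k) ^ k : ℕ) = 0 := by
  let f (k : ℕ) : ℤ := if k = n then 0 else
    (-1) ^ k * (Nat.card {G : SimpleGraph (Fin (n - k)) // G.IsTree} * (n - k) ^ k : ℕ)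
  calc
    _ = ∑ k ∈ range (n + 1), n.choose k • f k := by
      rw [sum_range_succ, show f n = 0 from if_pos rfl, smul_zero, add_zero]
      refine sum_congr rfl fun k hk ↦ ?_
      rw [show f k = _ from if_neg (mem_range.1 hk).ne, nsmul_eq_mul]
      ring
    _ = ∑ t : Finset (Fin n), f #t := by
      rw [← powerset_univ, sum_powerset_apply_card, card_univ, Fintype.card_fin]
    _ = ∑ t : Finset (Fin n), (-1 : ℤ) ^ #t *
        Nat.card {G : SimpleGraph (Fin n) // G.IsTree ∧ ∀ v ∈ t, G.IsLeaf v} := by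
      refine sum_congr rfl fun t _ ↦ ?_
      by_cases ht : #t = n
      · obtain rfl : t = univ := by rwa [← card_eq_iff_eq_univ, Fintype.card_fin]
        simp [f, card_isTree_isLeaf_eq_zero hn]
      · have hlt : #t < n := lt_of_le_of_ne (by simpa using t.card_le_univ) ht
        rw [show f #t = _ from if_neg ht, card_isTree_isLeaf_of_mem hlt]
    _ = 0 := sum_neg_one_pow_mul_card_isTree_isLeaf hn.le

/-- Cayley's formula, including the case of a single vertex. -/
lemma SimpleGraph.card_isTree_fin {n : ℕ} (hn : n ≠ 0) :
    Nat.card {G : SimpleGraph (Fin n) // G.IsTree} = n ^ (n - 2) := by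
  induction n using Nat.strong_induction_on with
  | _ n ih =>
  rcases le_or_gt n 2 with h2 | h2
  · rw [card_isTree_of_le_two hn h2]
    interval_cases n <;> simp_all
  have h1 := sum_neg_one_pow_mul_choose_mul_card_isTree h2
  have h3 := sum_neg_one_pow_mul_choose_mul_sub_pow (show n - 2 < n by omega)
  rw [sum_range_succ, Nat.sub_self, Nat.cast_zero, zero_pow (by omega), mul_zero, add_zero] at h3
  obtain ⟨m, rfl⟩ := Nat.exists_eq_succ_of_ne_zero hn
  have hpow : ∀ k ∈ range m, Nat.card {G : SimpleGraph (Fin (m + 1 - (k + 1))) // G.IsTree} *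
      (m + 1 - (k + 1)) ^ (k + 1) = (m + 1 - (k + 1)) ^ (m + 1 - 2) := by
    intro k hk
    have hk := mem_range.1 hk
    rw [ih _ (by omega) (by omega), ← pow_add]
    obtain h | h := Nat.lt_or_ge (k + 1) m
    · congr 1
      omega
    · simp [show m + 1 - (k + 1) = 1 by omega]
  rw [sum_range_succ'] at h1 h3
  rw [sum_congr rfl fun k hk ↦ by rw [hpow k hk, Nat.cast_pow]] at h1
  have := add_left_cancel (h1.trans h3.symm)
  simp only [pow_zero, Nat.choose_zero_right, Nat.cast_one, one_mul, mul_one, Nat.sub_zero] at this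
  exact_mod_cast this

/-- Cayley's formula: the number of labeled trees on `n ≥ 2` vertices,
i.e., simple graphs on `Fin n` that are trees, is `n ^ (n - 2)`. -/
theorem cayley_formula (n : ℕ) (hn : 2 ≤ n) :
    Nat.card {G : SimpleGraph (Fin n) // G.IsTree} = n ^ (n - 2) :=
  SimpleGraph.card_isTree_fin (by omega)
end

section
/- Let n ≥ 1 and p ∈ [0,1]. For each vertex v of Fin n independently, with probability p choose a target w uniformly at random from Fin n and create a directed edge from v to w (so each vertex's outedge is distributed as: no edge with probability 1-p, and edge to each specific w with probability p/n). Then the probability that the resulting directed graph contains a directed cycle (including self-loops) is exactly p. Formally: under the product probability measure on functions f : Fin n → Option (Fin n) in which each coordinate is independently 'none' with probability 1-p and 'some w' with probability p/n for each w, the probability of the event that there exists m ≥ 1 and vertices v_0, v_1, ..., v_{m-1} with f(v_i) = some v_{(i+1) mod m} for all i, equals p. -/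
open MeasureTheory

/-- The discrete σ-algebra on the finite type `Option (Fin n)`. -/
instance {n : ℕ} : MeasurableSpace (Option (Fin n)) := ⊤

/-- `f : Fin n → Option (Fin n)` encodes a partial functional digraph; it has a
directed cycle if there are `m ≥ 1` and vertices `v 0, …, v (m-1)` with
`f (v i) = some (v ((i+1) % m))` for all `i < m`. -/
def HasDirCycle {n : ℕ} (f : Fin n → Option (Fin n)) : Prop :=
  ∃ m : ℕ, 1 ≤ m ∧ ∃ v : ℕ → Fin n, ∀ i < m, f (v i) = some (v ((i + 1) % m))

namespace FunctionalDigraph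

variable {V : Type*}

/-- Following the outedge of a vertex; `none` is absorbing. -/
def step (f : V → Option V) : Option V → Option V := fun o => o.bind f

/-- There is a vertex from which one can walk along outedges forever. -/
def HasInfiniteWalk (f : V → Option V) : Prop :=
  ∃ v, ∀ k, (step f)^[k] (some v) ≠ none

lemma step_iterate_none (f : V → Option V) (k : ℕ) : (step f)^[k] none = none :=
  Function.iterate_fixed rfl k

lemma step_some (f : V → Option V) (v : V) : step f (some v) = f v := rfl

lemma hasDirCycle_iff_hasInfiniteWalk {n : ℕ} (f : Fin n → Option (Fin n)) :
    HasDirCycle f ↔ HasInfiniteWalk f := by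
  constructor
  · rintro ⟨m, hm, v, hv⟩
    refine ⟨v 0, fun k => ?_⟩
    have key : (step f)^[k] (some (v 0)) = some (v (k % m)) := by
      induction k with
      | zero => simp
      | succ k ih =>
        rw [Function.iterate_succ_apply', ih]
        simp [step, hv _ (Nat.mod_lt k hm), Nat.mod_add_mod]
    simp [key]
  · rintro ⟨v, hv⟩
    choose a ha using fun k => Option.ne_none_iff_exists'.mp (hv k)
    have hstep : ∀ k, f (a k) = some (a (k + 1)) := fun k => by
      rw [← ha (k + 1), Function.iterate_succ_apply', ha k]; rfl
    obtain ⟨i, j, hij, h⟩ : ∃ i j, i < j ∧ a i = a j := by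
      obtain ⟨i, j, hne, h⟩ := Finite.exists_ne_map_eq_of_infinite a
      rcases hne.lt_or_gt with hlt | hlt
      · exact ⟨i, j, hlt, h⟩
      · exact ⟨j, i, hlt, h.symm⟩
    refine ⟨j - i, by omega, fun t => a (i + t), fun t ht => ?_⟩
    rw [hstep]
    rcases (Nat.succ_le_of_lt ht).lt_or_eq with hlt | heq
    · rw [Nat.mod_eq_of_lt hlt, add_assoc]
    · have : i + t + 1 = j := by omega
      rw [this, show t + 1 = j - i from heq, Nat.mod_self]
      exact congrArg some h.symm

variable [Fintype V] [DecidableEq V]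

/-- The adjacency matrix of the functional digraph `f`. -/
def adjMatrix (f : V → Option V) : Matrix V V ℝ :=
  Matrix.of fun v w => if f v = some w then 1 else 0

lemma adjMatrix_pow_apply (f : V → Option V) (k : ℕ) (v w : V) :
    (adjMatrix f ^ k) v w = if (step f)^[k] (some v) = some w then 1 else 0 := by
  induction k generalizing v with
  | zero => simp [Matrix.one_apply]
  | succ k ih =>
    rw [pow_succ', Matrix.mul_apply, Function.iterate_succ_apply]
    simp only [ih, step_some]
    rcases (f v).eq_none_or_eq_some with h | ⟨u, h⟩
    · simp [adjMatrix, h, step_iterate_none]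
    · simp only [adjMatrix, Matrix.of_apply, h, Option.some.injEq, ite_mul, one_mul, zero_mul,
        Finset.sum_ite_eq, Finset.mem_univ, if_true]

lemma det_one_sub_of_isNilpotent {N : Matrix V V ℝ} (hN : IsNilpotent N) :
    (1 - N).det = 1 := by
  have h := (Matrix.isNilpotent_charpoly_sub_pow_of_isNilpotent hN).eq_zero
  simpa [Matrix.eval_charpoly] using congrArg (Polynomial.eval 1) (sub_eq_zero.mp h)

open Classical in
/-- The determinant of `1 - A` detects acyclicity of a functional digraph. -/
lemma det_one_sub_adjMatrix (f : V → Option V) :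
    (1 - adjMatrix f).det = if HasInfiniteWalk f then 0 else 1 := by
  split_ifs with hf
  · obtain ⟨v, hv⟩ := hf
    refine Matrix.exists_mulVec_eq_zero_iff.mp
      ⟨fun u => if ∀ k, (step f)^[k] (some u) ≠ none then 1 else 0, fun h => ?_, ?_⟩
    · simpa [hv] using congrFun h v
    · have hshift : ∀ u, (∀ k, (step f)^[k] (some u) ≠ none) ↔
          ∀ k, (step f)^[k] (f u) ≠ none := fun u =>
        ⟨fun h k => h (k + 1), fun h k => by
          cases k with
          | zero => simp
          | succ k => exact h k⟩
      ext u
      rw [Matrix.sub_mulVec, Matrix.one_mulVec, Pi.sub_apply, if_congr (hshift u) rfl rfl]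
      simp only [Matrix.mulVec, dotProduct, adjMatrix, Matrix.of_apply]
      rcases h : f u with _ | w
      · simp [step_iterate_none]
      · simp only [Option.some.injEq, ite_mul, one_mul, zero_mul, Finset.sum_ite_eq,
          Finset.mem_univ, if_true, sub_self, Pi.zero_apply]
  · apply det_one_sub_of_isNilpotent
    simp only [HasInfiniteWalk, not_exists, not_forall, not_not] at hf
    choose k hk using hf
    refine ⟨∑ v, k v, ?_⟩
    ext v w
    have hle : k v ≤ ∑ v, k v := Finset.single_le_sum (fun _ _ => Nat.zero_le _) (Finset.mem_univ v)
    rw [adjMatrix_pow_apply, ← Nat.sub_add_cancel hle, Function.iterate_add_apply, hk,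
      step_iterate_none]
    simp

/-- A rank-one matrix-forest identity: only the acyclic digraphs contribute to the sum. -/
lemma sum_prod_mul_det (w : Option V → ℝ) (hw : ∑ c, w c = 1) :
    ∑ f : V → Option V, (∏ v, w (f v)) * (1 - adjMatrix f).det = 1 - ∑ v, w (some v) := by
  have hrow : (fun v => ∑ c, w c • fun u => (1 : Matrix V V ℝ) v u - if c = some u then 1 else 0)
      = (1 - Matrix.vecMulVec 1 (fun u => w (some u)) : Matrix V V ℝ) := by
    ext v u
    simp only [Finset.sum_apply, Pi.smul_apply, smul_eq_mul, mul_sub, Finset.sum_sub_distrib,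
      ← Finset.sum_mul, hw]
    simp
  have hdet : (1 - Matrix.vecMulVec 1 (fun u => w (some u)) : Matrix V V ℝ).det
      = 1 - ∑ v, w (some v) := by
    have h := Matrix.det_one_add_replicateCol_mul_replicateRow (ι := Unit)
      (1 : V → ℝ) (-fun u => w (some u))
    rw [← Matrix.vecMulVec_eq, Matrix.vecMulVec_neg, ← sub_eq_add_neg] at h
    rw [h]
    simp [dotProduct, sub_eq_add_neg]
  rw [← hdet, ← hrow]
  change _ = (Matrix.detRowAlternating (R := ℝ) (n := V)).toMultilinearMap _
  rw [MultilinearMap.map_sum]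
  refine Finset.sum_congr rfl fun f _ => ?_
  rw [MultilinearMap.map_smul_univ]
  rfl

open Classical in
lemma sum_prod_filter_hasInfiniteWalk (w : Option V → ℝ) (hw : ∑ c, w c = 1) :
    ∑ f : V → Option V with HasInfiniteWalk f, ∏ v, w (f v) = ∑ v, w (some v) := by
  have htotal : ∑ f : V → Option V, ∏ v, w (f v) = 1 := by
    simpa [hw] using (Finset.prod_univ_sum (fun _ : V => Finset.univ) fun _ => w).symm
  have h := sum_prod_mul_det w hw
  simp only [det_one_sub_adjMatrix, mul_ite, mul_zero, mul_one] at h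
  rw [← Finset.sum_filter_add_sum_filter_not _ (fun f => HasInfiniteWalk f)] at htotal
  rw [Finset.sum_ite, Finset.sum_const_zero, zero_add] at h
  linarith

end FunctionalDigraph

/-- If each of `n ≥ 1` vertices independently gets no outedge with probability
`1 - p` and an outedge to each specific vertex with probability `p / n`, then
the probability that the resulting digraph contains a directed cycle is `p`. -/
theorem prob_cycle_uniform (n : ℕ) (hn : 1 ≤ n) (p : ℝ) (hp0 : 0 ≤ p) (hp1 : p ≤ 1) :
    Measure.pi (fun _ : Fin n =>
        ENNReal.ofReal (1 - p) • Measure.dirac (none : Option (Fin n)) +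
          ∑ w : Fin n, ENNReal.ofReal (p / n) • Measure.dirac (some w))
      {f | HasDirCycle f} = ENNReal.ofReal p := by
  classical
  set μ : Measure (Option (Fin n)) := ENNReal.ofReal (1 - p) • Measure.dirac none +
    ∑ w : Fin n, ENNReal.ofReal (p / n) • Measure.dirac (some w) with hμ
  have hn0 : (n : ℝ) ≠ 0 := by positivity
  let w : Option (Fin n) → ℝ := fun c => c.elim (1 - p) fun _ => p / n
  have hsome : ∑ v : Fin n, w (some v) = p := by simp [w]; field_simp
  have hw : ∑ c, w c = 1 := by rw [Fintype.sum_option, hsome]; simp [w]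
  have hw0 : ∀ c, 0 ≤ w c := by
    rintro (_ | v)
    · exact sub_nonneg.mpr hp1
    · exact div_nonneg hp0 n.cast_nonneg
  have : DiscreteMeasurableSpace (Option (Fin n)) := ⟨fun _ => trivial⟩
  have hsingleton : ∀ c, μ {c} = ENNReal.ofReal (w c) := by
    rintro (_ | v)
    · simp [hμ, w]
    · simp [hμ, w, Set.indicator_apply]
  have : IsFiniteMeasure μ := ⟨by
    rw [← Finset.coe_univ, ← sum_measure_singleton]
    simp [hsingleton]⟩
  have hset : {f : Fin n → Option (Fin n) | HasDirCycle f} =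
      ((Finset.univ.filter fun f : Fin n → Option (Fin n) => FunctionalDigraph.HasInfiniteWalk f :
        Finset _) : Set (Fin n → Option (Fin n))) := by
    ext f
    simp [FunctionalDigraph.hasDirCycle_iff_hasInfiniteWalk]
  rw [hset, ← sum_measure_singleton]
  simp only [Measure.pi_singleton, hsingleton]
  simp only [← ENNReal.ofReal_prod_of_nonneg fun v _ => hw0 _]
  rw [← ENNReal.ofReal_sum_of_nonneg fun f _ => Finset.prod_nonneg fun v _ => hw0 _,
    FunctionalDigraph.sum_prod_filter_hasInfiniteWalk w hw, hsome]
end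

section
/- Let n ≥ 1 and let p : Fin n → [0,1] assign a probability p_v to each vertex v. For each vertex v independently, with probability p_v choose a target w uniformly at random from Fin n and create a directed edge from v to w (so vertex v's outedge is 'none' with probability 1 - p_v and 'some w' with probability p_v/n for each w). Then the probability that the resulting directed graph contains a directed cycle equals the average (∑_v p_v)/n. -/
open MeasureTheory

section CycleWeight

open Finset Function

theorem hasDirCycle_iff_exists_closed {n : ℕ} (f : Fin n → Option (Fin n)) :
    HasDirCycle f ↔ ∃ C : Set (Fin n), C.Nonempty ∧ ∀ u ∈ C, ∃ w ∈ C, f u = some w := by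
  constructor
  · rintro ⟨m, hm, v, hv⟩
    refine ⟨v '' Set.Iio m, ⟨v 0, 0, hm, rfl⟩, ?_⟩
    rintro _ ⟨i, hi, rfl⟩
    exact ⟨v ((i + 1) % m), ⟨_, Nat.mod_lt _ hm, rfl⟩, hv i hi⟩
  · rintro ⟨C, ⟨c, hc⟩, hC⟩
    choose! F hFC hF using hC
    have hmem : ∀ k, F^[k] c ∈ C := fun k => by
      induction k with
      | zero => exact hc
      | succ k ih => rw [iterate_succ_apply']; exact hFC _ ih
    obtain ⟨i, j, hij, h⟩ : ∃ i j, i < j ∧ F^[i] c = F^[j] c := by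
      obtain ⟨i, j, hne, h⟩ := Finite.exists_ne_map_eq_of_infinite fun k => F^[k] c
      rcases hne.lt_or_gt with hlt | hlt
      exacts [⟨i, j, hlt, h⟩, ⟨j, i, hlt, h.symm⟩]
    refine ⟨j - i, by omega, fun k => F^[i + k] c, fun k hk => ?_⟩
    rw [hF _ (hmem _), ← iterate_succ_apply' F]
    rcases Nat.lt_or_ge (k + 1) (j - i) with hlt | hge
    · rw [Nat.mod_eq_of_lt hlt]; rfl
    · obtain rfl : j = i + k + 1 := by omega
      rw [show i + k + 1 - i = k + 1 by omega, Nat.mod_self]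
      exact congrArg some h.symm

/-- Giving the sink `v` an edge to `w ≠ v` has the same effect on directed cycles as
redirecting to `w` all edges that point to `v`. -/
theorem hasDirCycle_update_iff {n : ℕ} {f : Fin n → Option (Fin n)} {v w : Fin n}
    (hw : w ≠ v) (hf : f v = none) :
    HasDirCycle (update f v (some w)) ↔
      HasDirCycle fun u => (f u).map (update id v w) := by
  simp only [hasDirCycle_iff_exists_closed]
  constructor
  · rintro ⟨C, ⟨c, hc⟩, hC⟩
    have hwC : v ∈ C → w ∈ C := fun hv => by
      obtain ⟨y, hy, h⟩ := hC v hv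
      simp only [update_self, Option.some.injEq] at h
      exact h ▸ hy
    refine ⟨C \ {v}, ?_, ?_⟩
    · by_cases h : c = v
      · exact ⟨w, hwC (h ▸ hc), hw⟩
      · exact ⟨c, hc, h⟩
    · rintro u ⟨hu, huv⟩
      obtain ⟨y, hy, h⟩ := hC u hu
      rw [update_of_ne huv] at h
      by_cases hyv : y = v
      · subst hyv
        exact ⟨w, ⟨hwC hy, hw⟩, by simp [h]⟩
      · exact ⟨y, ⟨hy, hyv⟩, by simp [h, update_of_ne hyv]⟩
  · rintro ⟨C, ⟨c, hc⟩, hC⟩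
    have hvC : ∀ u ∈ C, u ≠ v := by
      rintro u hu rfl
      obtain ⟨y, -, h⟩ := hC u hu
      simp [hf] at h
    refine ⟨{u | update id v w u ∈ C}, ⟨c, ?_⟩, fun u hu => ?_⟩
    · simpa [update_of_ne (hvC c hc)] using hc
    · by_cases huv : u = v
      · subst huv
        exact ⟨w, by simpa [update_of_ne hw] using hu, by simp⟩
      · have hu' : u ∈ C := by simpa [update_of_ne huv] using hu
        obtain ⟨y, hy, h⟩ := hC u hu'
        obtain ⟨z, hz, rfl⟩ := Option.map_eq_some_iff.1 h
        exact ⟨z, hy, by rw [update_of_ne huv, hz]⟩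

theorem not_hasDirCycle_of_forall_eq_none {n : ℕ} {f : Fin n → Option (Fin n)}
    (hf : ∀ u, f u = none) : ¬ HasDirCycle f := by
  rintro ⟨m, hm, v, hv⟩
  simpa [hf] using hv 0 hm

theorem hasDirCycle_update_self {n : ℕ} (f : Fin n → Option (Fin n)) (v : Fin n) :
    HasDirCycle (update f v (some v)) :=
  ⟨1, le_rfl, fun _ => v, fun _ _ => by simp⟩

variable {n : ℕ}

/-- The weight of the outedge `o` at the vertex `u`, when an edge is present with probability
`p u` and has target `w` with probability `x w`. -/
def edgeWeight (p x : Fin n → ℝ) (u : Fin n) : Option (Fin n) → ℝ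
  | none => 1 - p u
  | some w => p u * x w

/-- The expectation of `G` when all outedges are drawn independently according to
`edgeWeight p x`. -/
def edgeExpect (p x : Fin n → ℝ) (G : (Fin n → Option (Fin n)) → ℝ) : ℝ :=
  ∑ f, (∏ u, edgeWeight p x u (f u)) * G f

theorem sum_edgeWeight (p : Fin n → ℝ) {x : Fin n → ℝ} (hx : ∑ w, x w = 1) (u : Fin n) :
    ∑ o, edgeWeight p x u o = 1 := by
  simp [Fintype.sum_option, edgeWeight, ← mul_sum, hx]

theorem edgeExpect_one (p : Fin n → ℝ) {x : Fin n → ℝ} (hx : ∑ w, x w = 1) :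
    edgeExpect p x (fun _ => 1) = 1 := by
  have h := (prod_univ_sum (fun _ => univ) (edgeWeight p x)).symm
  simpa [edgeExpect, sum_edgeWeight p hx] using h

theorem edgeExpect_congr {p x : Fin n → ℝ} {G H : (Fin n → Option (Fin n)) → ℝ}
    (h : ∀ f, (∀ u, p u = 0 → f u = none) → G f = H f) :
    edgeExpect p x G = edgeExpect p x H := by
  refine sum_congr rfl fun f _ => ?_
  by_cases hf : ∀ u, p u = 0 → f u = none
  · rw [h f hf]
  · push Not at hf
    obtain ⟨u, hu, hfu⟩ := hf
    obtain ⟨w, hw⟩ := Option.ne_none_iff_exists'.1 hfu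
    rw [prod_eq_zero (mem_univ u) (by simp [hw, edgeWeight, hu]), zero_mul, zero_mul]

/-- Conditioning on the outedge of the vertex `v`. -/
theorem edgeExpect_eq_sum_update (p x : Fin n → ℝ) (v : Fin n)
    (G : (Fin n → Option (Fin n)) → ℝ) :
    edgeExpect p x G = ∑ o, edgeWeight p x v o *
      edgeExpect (update p v 0) x (fun f => G (update f v o)) := by
  have hprod : ∀ (q : Fin n → ℝ) (f : Fin n → Option (Fin n)),
      ∏ u, edgeWeight q x u (f u) =
        edgeWeight q x v (f v) * ∏ u : {u // u ≠ v}, edgeWeight q x u (f u) := fun q f =>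
    Fintype.prod_eq_mul_prod_subtype_ne _ v
  have hsplit : ∀ (H : (Fin n → Option (Fin n)) → ℝ), ∑ f, H f =
      ∑ a, ∑ g, H ((Equiv.funSplitAt v (Option (Fin n))).symm (a, g)) := fun H => by
    rw [← Fintype.sum_prod_type', ← Equiv.sum_comp (Equiv.funSplitAt v (Option (Fin n))).symm]
  have hself : ∀ (a : Option (Fin n)) g,
      (Equiv.funSplitAt v (Option (Fin n))).symm (a, g) v = a := fun a g => by simp
  have hne : ∀ (a : Option (Fin n)) g (u : {u // u ≠ v}),
      (Equiv.funSplitAt v (Option (Fin n))).symm (a, g) u = g u := fun a g u => by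
    simp [u.2]
  have hupd : ∀ (a o : Option (Fin n)) g,
      update ((Equiv.funSplitAt v (Option (Fin n))).symm (a, g)) v o =
        (Equiv.funSplitAt v (Option (Fin n))).symm (o, g) := fun a o g => by
    ext1 u
    by_cases h : u = v
    · subst h; simp
    · simp [h]
  have hweight : ∀ (u : {u // u ≠ v}) o,
      edgeWeight (update p v 0) x u o = edgeWeight p x u o := fun u o => by
    cases o <;> simp [edgeWeight, u.2]
  unfold edgeExpect
  rw [hsplit]
  refine sum_congr rfl fun o _ => ?_
  rw [hsplit]
  simp only [hprod, hself, hne, hupd, hweight]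
  rw [Fintype.sum_option]
  simp [edgeWeight, mul_sum, mul_assoc]

/-- The pushforward of the target distribution `x` under `r`. -/
def pushWeight (r : Fin n → Fin n) (x : Fin n → ℝ) (z : Fin n) : ℝ :=
  ∑ y with r y = z, x y

theorem sum_mul_pushWeight (r : Fin n → Fin n) (x q : Fin n → ℝ) :
    ∑ z, q z * pushWeight r x z = ∑ y, q (r y) * x y := by
  rw [← sum_fiberwise univ r fun y => q (r y) * x y]
  refine sum_congr rfl fun z _ => ?_
  rw [pushWeight, mul_sum]
  exact sum_congr rfl fun y hy => by rw [(mem_filter.1 hy).2]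

theorem edgeWeight_pushWeight (p x : Fin n → ℝ) (r : Fin n → Fin n) (u : Fin n)
    (o : Option (Fin n)) :
    edgeWeight p (pushWeight r x) u o = ∑ a with a.map r = o, edgeWeight p x u a := by
  rw [sum_filter, Fintype.sum_option]
  cases o <;> simp [edgeWeight, pushWeight, mul_sum, sum_filter]

theorem edgeExpect_map (p x : Fin n → ℝ) (r : Fin n → Fin n)
    (G : (Fin n → Option (Fin n)) → ℝ) :
    edgeExpect p x (fun f => G fun u => (f u).map r) = edgeExpect p (pushWeight r x) G := by
  unfold edgeExpect
  rw [← sum_fiberwise univ fun (f : Fin n → Option (Fin n)) u => (f u).map r]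
  refine sum_congr rfl fun g _ => ?_
  simp only [edgeWeight_pushWeight]
  rw [prod_univ_sum, sum_mul]
  refine sum_congr ?_ fun f hf => ?_
  · ext f
    simp [funext_iff]
  · have : (fun u => (f u).map r) = g := by
      ext1 u
      simpa using Fintype.mem_piFinset.1 hf u
    rw [this]

open Classical in
theorem edgeExpect_hasDirCycle (p x : Fin n → ℝ) (hx : ∑ w, x w = 1) :
    edgeExpect p x (fun f => if HasDirCycle f then 1 else 0) = ∑ v, p v * x v := by
  suffices H : ∀ (S : Finset (Fin n)) (p x : Fin n → ℝ), (∀ u ∉ S, p u = 0) →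
      ∑ w, x w = 1 →
      edgeExpect p x (fun f => if HasDirCycle f then 1 else 0) = ∑ v, p v * x v from
    H univ p x (by simp) hx
  intro S
  induction S using Finset.induction_on with
  | empty =>
    intro p x hp hx
    rw [edgeExpect_congr (H := fun _ => 0) fun f hf => ?_]
    · simp [edgeExpect, hp _ (notMem_empty _)]
    · exact if_neg (not_hasDirCycle_of_forall_eq_none fun u => hf u (hp u (notMem_empty u)))
  | insert v S hv ih =>
    intro p x hp hx
    have hp0 : ∀ u ∉ S, update p v 0 u = 0 := fun u hu => by
      by_cases h : u = v
      · simp [h]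
      · rw [update_of_ne h]
        exact hp u (by simp [h, hu])
    set q := update p v 0 with hq
    have hqv : q v = 0 := update_self ..
    set c := ∑ u, q u * x u with hc
    have hnone : edgeExpect q x (fun f => if HasDirCycle (update f v none) then 1 else 0) = c := by
      rw [hc, ← ih q x hp0 hx]
      refine edgeExpect_congr fun f hf => ?_
      rw [← hf v hqv, update_eq_self]
    have hsome : ∀ w, edgeExpect q x
        (fun f => if HasDirCycle (update f v (some w)) then 1 else 0) =
          c + q w * x v + if w = v then 1 - c else 0 := by
      intro w
      by_cases hw : w = v
      · subst hw
        simp [hasDirCycle_update_self, edgeExpect_one q hx, hqv]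
      · rw [edgeExpect_congr fun f hf => if_congr (hasDirCycle_update_iff hw (hf v hqv)) rfl rfl,
          edgeExpect_map q x _ fun f => if HasDirCycle f then 1 else 0, ih _ _ hp0,
          sum_mul_pushWeight, if_neg hw, add_zero]
        · rw [hc, ← add_sum_erase _ _ (mem_univ v), ← add_sum_erase _ _ (mem_univ v), hqv]
          rw [sum_congr rfl fun u hu => by
            rw [update_of_ne (ne_of_mem_erase hu)]]
          simp [add_comm]
        · simpa [hx] using sum_mul_pushWeight (update id v w) x fun _ => 1
    have hpc : ∑ u, p u * x u = p v * x v + c := by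
      rw [hc, ← add_sum_erase _ _ (mem_univ v), ← add_sum_erase _ _ (mem_univ v), hqv,
        zero_mul, zero_add]
      congr 1
      exact sum_congr rfl fun u hu => by rw [hq, update_of_ne (ne_of_mem_erase hu)]
    have hsum : ∑ w, x w * (c + q w * x v + if w = v then 1 - c else 0) = c + x v := by
      have h : ∑ w, x w * (q w * x v) = c * x v := by
        rw [hc, sum_mul]
        exact sum_congr rfl fun w _ => by ring
      simp only [mul_add, sum_add_distrib, ← sum_mul, hx, h, mul_ite, mul_zero,
        sum_ite_eq', mem_univ, if_true]
      ring
    rw [edgeExpect_eq_sum_update p x v, Fintype.sum_option, ← hq, hnone]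
    simp only [hsome, edgeWeight, mul_assoc]
    rw [← mul_sum, hsum, hpc]
    ring

end CycleWeight

/-- If each vertex `v` of `Fin n` (`n ≥ 1`) independently gets no outedge with
probability `1 - p v` and an outedge to each specific vertex with probability
`p v / n`, then the probability of a directed cycle is `(∑ v, p v) / n`. -/
theorem prob_cycle_varying (n : ℕ) (hn : 1 ≤ n) (p : Fin n → ℝ)
    (hp0 : ∀ v, 0 ≤ p v) (hp1 : ∀ v, p v ≤ 1) :
    Measure.pi (fun v : Fin n =>
        ENNReal.ofReal (1 - p v) • Measure.dirac (none : Option (Fin n)) +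
          ∑ w : Fin n, ENNReal.ofReal (p v / n) • Measure.dirac (some w))
      {f | HasDirCycle f} = ENNReal.ofReal ((∑ v, p v) / n) := by
  classical
  have hn' : (n : ℝ) ≠ 0 := by positivity
  have hweight : ∀ v o, 0 ≤ edgeWeight p (fun _ => (n : ℝ)⁻¹) v o := by
    rintro v (_ | w)
    · exact sub_nonneg.2 (hp1 v)
    · exact mul_nonneg (hp0 v) (by positivity)
  have hsingleton : ∀ v o, (ENNReal.ofReal (1 - p v) • Measure.dirac (none : Option (Fin n)) +
      ∑ w : Fin n, ENNReal.ofReal (p v / n) • Measure.dirac (some w)) {o} =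
        ENNReal.ofReal (edgeWeight p (fun _ => (n : ℝ)⁻¹) v o) := by
    rintro v (_ | w) <;>
      simp [edgeWeight, Set.indicator_apply, div_eq_mul_inv]
  have hfin : ∀ v, IsFiniteMeasure (ENNReal.ofReal (1 - p v) •
      Measure.dirac (none : Option (Fin n)) +
        ∑ w : Fin n, ENNReal.ofReal (p v / n) • Measure.dirac (some w)) := fun v => by
    have : ∀ w : Fin n, IsFiniteMeasure
        (ENNReal.ofReal (p v / n) • Measure.dirac (some w)) := fun w =>
      Measure.smul_finite _ ENNReal.ofReal_ne_top
    have := Measure.smul_finite (Measure.dirac (none : Option (Fin n)))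
      (ENNReal.ofReal_ne_top (r := 1 - p v))
    infer_instance
  rw [← Set.coe_toFinset {f : Fin n → Option (Fin n) | HasDirCycle f}, ← sum_measure_singleton]
  simp only [Measure.pi_singleton, hsingleton]
  simp only [← ENNReal.ofReal_prod_of_nonneg fun v _ => hweight v _]
  rw [← ENNReal.ofReal_sum_of_nonneg fun f _ => Finset.prod_nonneg fun v _ => hweight v _]
  have h := edgeExpect_hasDirCycle p (fun _ => (n : ℝ)⁻¹) (by simp [hn'])
  rw [← Finset.sum_mul, ← div_eq_mul_inv] at h
  rw [← h, edgeExpect]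
  simp [Finset.sum_filter]
end

section
/- Let n ≥ 1, p ∈ [0,1], and let π be a probability distribution on Fin n (π : Fin n → [0,1] with ∑_w π(w) = 1). For each vertex v independently, with probability p choose a target w according to π and create a directed edge from v to w (so each vertex's outedge is 'none' with probability 1-p and 'some w' with probability p·π(w)). Then the probability that the resulting directed graph contains a directed cycle equals p. -/
open MeasureTheory

/-- A rank function witnessing that the partial function `f` has no directed cycle. -/
def HasRank {n : ℕ} (f : Fin n → Option (Fin n)) : Prop :=
  ∃ h : Fin n → ℕ, ∀ v w, f v = some w → h w < h v

lemma exists_path_of_transGen {n : ℕ} {f : Fin n → Option (Fin n)} {a b : Fin n}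
    (h : Relation.TransGen (fun v w => f v = some w) a b) :
    ∃ k : ℕ, 1 ≤ k ∧ ∃ u : ℕ → Fin n, u 0 = a ∧ u k = b ∧ ∀ i < k, f (u i) = some (u (i + 1)) := by
  induction h with
  | @single b hab => exact ⟨1, le_rfl, fun i => if i = 0 then a else b, by simp, by simp,
      fun i hi => by obtain rfl : i = 0 := by omega
                     simpa using hab⟩
  | @tail b c _ hbc ih =>
    obtain ⟨k, hk, u, h0, hkb, hu⟩ := ih
    refine ⟨k + 1, by omega, fun i => if i ≤ k then u i else c, by simpa using h0, by simp, ?_⟩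
    intro i hi
    rcases Nat.lt_succ_iff_lt_or_eq.mp hi with hlt | rfl
    · simpa [hlt.le, Nat.succ_le_of_lt hlt] using hu i hlt
    · simpa [hkb] using hbc

lemma hasDirCycle_of_transGen {n : ℕ} {f : Fin n → Option (Fin n)} {a : Fin n}
    (h : Relation.TransGen (fun v w => f v = some w) a a) : HasDirCycle f := by
  obtain ⟨k, hk, u, h0, hka, hu⟩ := exists_path_of_transGen h
  refine ⟨k, hk, u, fun i hi => ?_⟩
  rw [hu i hi]
  rcases (Nat.succ_le_of_lt hi).lt_or_eq with hlt | heq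
  · rw [Nat.mod_eq_of_lt hlt]
  · have heq : i + 1 = k := heq
    rw [heq, Nat.mod_self, hka, h0]

lemma not_hasDirCycle_iff_hasRank {n : ℕ} (f : Fin n → Option (Fin n)) :
    ¬ HasDirCycle f ↔ HasRank f := by
  classical
  constructor
  · intro hf
    refine ⟨fun v => (Finset.univ.filter
      (fun w => Relation.TransGen (fun v w => f v = some w) v w)).card, fun v w hvw => ?_⟩
    refine Finset.card_lt_card (Finset.ssubset_iff_of_subset ?_ |>.mpr ⟨w, ?_, ?_⟩)
    · intro x hx
      simp only [Finset.mem_filter, Finset.mem_univ, true_and] at hx ⊢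
      exact Relation.TransGen.head hvw hx
    · exact Finset.mem_filter.mpr ⟨Finset.mem_univ _, Relation.TransGen.single hvw⟩
    · exact fun h => hf (hasDirCycle_of_transGen (Finset.mem_filter.mp h).2)
  · rintro ⟨h, hh⟩ ⟨m, hm, v, hv⟩
    obtain ⟨i, hi, hmin⟩ := Finset.exists_min_image (Finset.range m) (fun i => h (v i))
      ⟨0, Finset.mem_range.mpr hm⟩
    have hlt := hh _ _ (hv i (by simpa using hi))
    have hle := hmin ((i + 1) % m) (by simpa using Nat.mod_lt _ hm)
    omega

/-- Redirect the target `0` to `r` and shift all other targets down by one. -/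
def contractZero {n : ℕ} (r : Option (Fin n)) (o : Option (Fin (n + 1))) : Option (Fin n) :=
  o.bind (Fin.cases r some)

lemma hasRank_cons_iff {n : ℕ} (r : Option (Fin n)) (g : Fin n → Option (Fin (n + 1))) :
    HasRank (Fin.cons (r.map Fin.succ) g : Fin (n + 1) → Option (Fin (n + 1))) ↔
      HasRank (fun i => contractZero r (g i)) := by
  constructor
  · rintro ⟨h, hh⟩
    refine ⟨fun i => h i.succ, fun i j hij => ?_⟩
    obtain ⟨x, hx, hxj⟩ := Option.bind_eq_some_iff.mp hij
    have h1 := hh i.succ x (by simpa using hx)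
    cases x using Fin.cases with
    | zero =>
      have h2 := hh 0 j.succ (by simpa using hxj)
      exact h2.trans h1
    | succ k =>
      obtain rfl : k = j := by simpa using hxj
      exact h1
  · rintro ⟨h, hh⟩
    refine ⟨Fin.cases (r.elim 0 fun j => 2 * h j + 3) fun i => 2 * h i + 2, fun v w hvw => ?_⟩
    cases v using Fin.cases with
    | zero =>
      obtain ⟨j, rfl, rfl⟩ : ∃ j, r = some j ∧ j.succ = w := by simpa using hvw
      simp
    | succ i =>
      have hgi : g i = some w := by simpa using hvw
      cases w using Fin.cases with
      | zero =>
        cases r with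
        | none => simp
        | some j =>
          have := hh i j (by simp [contractZero, hgi])
          simp only [Option.elim_some, Fin.cases_zero, Fin.cases_succ]
          omega
      | succ k =>
        have := hh i k (by simp [contractZero, hgi])
        simp only [Fin.cases_succ]
        omega

lemma not_hasRank_cons_zero {n : ℕ} (g : Fin n → Option (Fin (n + 1))) :
    ¬ HasRank (Fin.cons (some 0) g : Fin (n + 1) → Option (Fin (n + 1))) := by
  rintro ⟨h, hh⟩
  exact (hh 0 0 (by simp)).false

lemma sum_comp_mul_prod {ι α β R : Type*} [Fintype ι] [DecidableEq ι] [Fintype α] [Fintype β]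
    [DecidableEq β] [CommSemiring R] (φ : α → β) (w : α → R) (F : (ι → β) → R) :
    ∑ g : ι → α, F (fun i => φ (g i)) * ∏ i, w (g i) =
      ∑ g : ι → β, F g * ∏ i, ∑ x with φ x = g i, w x := by
  classical
  simp_rw [Finset.prod_univ_sum, Finset.mul_sum]
  rw [← Finset.sum_fiberwise Finset.univ (fun g : ι → α => fun i => φ (g i))]
  refine Finset.sum_congr rfl fun g' _ => ?_
  refine Finset.sum_congr ?_ ?_
  · ext g
    simp [Fintype.mem_piFinset, funext_iff]
  · intro g hg
    have : (fun i => φ (g i)) = g' := by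
      funext i
      simpa using Fintype.mem_piFinset.mp hg i
    rw [this]

open Classical in
theorem sum_hasRank_prod {R : Type*} [CommRing R] {n : ℕ} (w : Option (Fin n) → R)
    (hw : ∑ o, w o = 1) :
    ∑ f : Fin n → Option (Fin n), (if HasRank f then 1 else 0) * ∏ i, w (f i) = w none := by
  induction n with
  | zero =>
    have h (f : Fin 0 → Option (Fin 0)) : HasRank f := ⟨fun _ => 0, fun v => v.elim0⟩
    rw [Fintype.sum_option] at hw
    rw [Fintype.sum_unique, if_pos (h _)]
    simpa using hw.symm
  | succ n ih =>
    have key (r : Option (Fin n)) (a : Option (Fin (n + 1))) (ha : a = r.map Fin.succ) :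
        ∑ g : Fin n → Option (Fin (n + 1)),
          (if HasRank (Fin.cons a g : Fin (n + 1) → Option (Fin (n + 1)))
            then 1 else 0) * ∏ i, w (g i) = r.elim (w none + w (some 0)) fun _ => w none := by
      subst ha
      simp_rw [hasRank_cons_iff]
      rw [sum_comp_mul_prod (contractZero r) w (fun f => if HasRank f then 1 else 0),
        ih (fun o => ∑ x with contractZero r x = o, w x)]
      · rw [Finset.sum_filter, Fintype.sum_option, Fin.sum_univ_succ]
        cases r <;> simp [contractZero]
      · rw [← hw]
        exact Finset.sum_fiberwise _ _ _
    rw [← (Fin.consEquiv fun _ => Option (Fin (n + 1))).sum_comp, Fintype.sum_prod_type]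
    simp only [Fin.consEquiv_apply, Fin.prod_univ_succ, Fin.cons_zero, Fin.cons_succ,
      mul_left_comm _ (w _), ← Finset.mul_sum]
    rw [Fintype.sum_option, Fin.sum_univ_succ]
    have h0 := key none none rfl
    have hs (j : Fin n) := key (some j) (some j.succ) rfl
    simp only [Option.elim_none, Option.elim_some] at h0 hs
    have hz : ∑ g : Fin n → Option (Fin (n + 1)),
        (if HasRank (Fin.cons (some 0) g : Fin (n + 1) → Option (Fin (n + 1)))
          then 1 else 0) * ∏ i, w (g i) = 0 :=
      Finset.sum_eq_zero fun g _ => by rw [if_neg (not_hasRank_cons_zero g), zero_mul]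
    refine (congrArg₂ (· + ·) (congrArg (w none * ·) h0)
      (congrArg₂ (· + ·) (congrArg (w (some 0) * ·) hz)
        (Finset.sum_congr rfl fun j _ => congrArg (w (some j.succ) * ·) (hs j)))).trans ?_
    rw [Fintype.sum_option, Fin.sum_univ_succ] at hw
    rw [← Finset.sum_mul]
    linear_combination w none * hw

/-- If each vertex of `Fin n` (`n ≥ 1`) independently gets no outedge with
probability `1 - p` and an outedge to vertex `w` with probability `p * π w`,
where `π` is a probability distribution on `Fin n`, then the probability that
the resulting digraph contains a directed cycle is `p`. -/
theorem prob_cycle_distribution (n : ℕ) (hn : 1 ≤ n) (p : ℝ) (hp0 : 0 ≤ p) (hp1 : p ≤ 1)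
    (π : Fin n → ℝ) (hπ0 : ∀ w, 0 ≤ π w) (hπ1 : ∑ w, π w = 1) :
    Measure.pi (fun _ : Fin n =>
        ENNReal.ofReal (1 - p) • Measure.dirac (none : Option (Fin n)) +
          ∑ w : Fin n, ENNReal.ofReal (p * π w) • Measure.dirac (some w))
      {f | HasDirCycle f} = ENNReal.ofReal p := by
  classical
  set μ : Measure (Option (Fin n)) := ENNReal.ofReal (1 - p) • Measure.dirac none +
    ∑ w : Fin n, ENNReal.ofReal (p * π w) • Measure.dirac (some w) with hμ
  set q : Option (Fin n) → ℝ := fun o => o.elim (1 - p) fun w => p * π w with hq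
  have hq0 (o) : 0 ≤ q o := by
    cases o with
    | none => simpa [hq] using hp1
    | some w => exact mul_nonneg hp0 (hπ0 w)
  have hqsum : ∑ o, q o = 1 := by
    simp [hq, Fintype.sum_option, ← Finset.mul_sum, hπ1]
  have hμq (o) : μ {o} = ENNReal.ofReal (q o) := by
    cases o <;> simp [hμ, hq, Set.indicator_apply]
  have : IsFiniteMeasure μ := ⟨by simp [hμ, ENNReal.add_lt_top, ENNReal.sum_lt_top]⟩
  have hsingle (f : Fin n → Option (Fin n)) :
      Measure.pi (fun _ : Fin n => μ) {f} = ENNReal.ofReal (∏ i, q (f i)) := by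
    rw [Measure.pi_singleton, ENNReal.ofReal_prod_of_nonneg fun i _ => hq0 _]
    simp [hμq]
  have hset : {f : Fin n → Option (Fin n) | HasDirCycle f} =
      ↑(Finset.univ.filter fun f : Fin n → Option (Fin n) => HasDirCycle f) := by
    simp
  rw [hset, ← sum_measure_singleton]
  simp_rw [hsingle]
  rw [← ENNReal.ofReal_sum_of_nonneg fun f _ => Finset.prod_nonneg fun i _ => hq0 _]
  congr 1
  have htotal : ∑ f : Fin n → Option (Fin n), ∏ i, q (f i) = 1 := by
    have := Finset.prod_univ_sum (fun _ : Fin n => Finset.univ) (fun _ => q)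
    simpa [hqsum] using this.symm
  have hacyclic := sum_hasRank_prod q hqsum
  simp only [ite_mul, one_mul, zero_mul, ← Finset.sum_filter] at hacyclic
  rw [Finset.filter_congr fun f _ => (not_hasDirCycle_iff_hasRank f).symm] at hacyclic
  have hsplit := Finset.sum_filter_add_sum_filter_not Finset.univ
    (fun f : Fin n → Option (Fin n) => HasDirCycle f) (fun f => ∏ i, q (f i))
  rw [htotal, hacyclic] at hsplit
  have hnone : q none = 1 - p := rfl
  linarith
end

section
/- Let V be a finite set with |V| = n, and let A ⊆ V with |A| = k where 1 ≤ k. Then the number of functions g : A → V that contain no directed cycle — i.e., for which there is no sequence a_0, ..., a_{m-1} of elements of A (m ≥ 1) with g(a_i) = a_{(i+1) mod m} for all i — equals (n - k) · n^(k-1). Equivalently, a uniformly random function g : A → V contains a directed cycle with probability k/n. -/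
/-- `ExitsAt f A r v` says that iterating `f` from `v`, moving on only at points of `A`,
leads to `r`. -/
inductive ExitsAt {V : Type*} (f : V → V) (A : Finset V) (r : V) : V → Prop
  | base : ExitsAt f A r r
  | step {v : V} (hv : v ∈ A) (h : ExitsAt f A r (f v)) : ExitsAt f A r v

/-- Every orbit of `f` eventually leaves `A`. -/
def LeavesFrom {V : Type*} (f : V → V) (A : Finset V) : Prop :=
  ∀ v, ∃ r, r ∉ A ∧ ExitsAt f A r v

section

variable {V : Type*} {f g : V → V} {A : Finset V} {r s v : V}

namespace ExitsAt

theorem eq_of_notMem (h : ExitsAt f A r v) (hv : v ∉ A) : v = r := by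
  cases h with
  | base => rfl
  | step hv' _ => exact absurd hv' hv

theorem of_mem (h : ExitsAt f A r v) (hr : r ∉ A) (hv : v ∈ A) : ExitsAt f A r (f v) := by
  cases h with
  | base => exact absurd hv hr
  | step _ h => exact h

theorem unique (h : ExitsAt f A r v) (hr : r ∉ A) (hs : s ∉ A) (h' : ExitsAt f A s v) :
    r = s := by
  induction h with
  | base => exact h'.eq_of_notMem hr
  | step hv _ ih => exact ih (h'.of_mem hs hv)

theorem congr (h : ExitsAt f A r v) (hfg : ∀ x ∈ A, f x = g x) : ExitsAt g A r v := by
  induction h with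
  | base => exact base
  | step hv _ ih => exact step hv (hfg _ hv ▸ ih)

theorem mono {B : Finset V} (hAB : A ⊆ B) (h : ExitsAt f A r v) : ExitsAt f B r v := by
  induction h with
  | base => exact base
  | step hv _ ih => exact step (hAB hv) ih

theorem conj (e : Equiv.Perm V) (he : ∀ x ∈ A, e x ∈ A) (h : ExitsAt f A r v) :
    ExitsAt (fun x => e (f (e.symm x))) A (e r) (e v) := by
  induction h with
  | base => exact base
  | step hv _ ih => exact step (he _ hv) (by simpa using ih)

end ExitsAt

namespace LeavesFrom

theorem congr (h : LeavesFrom f A) (hfg : ∀ x ∈ A, f x = g x) : LeavesFrom g A := fun v =>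
  let ⟨r, hr, hv⟩ := h v
  ⟨r, hr, hv.congr hfg⟩

theorem conj (e : Equiv.Perm V) (he : ∀ x, e x ∈ A ↔ x ∈ A) (h : LeavesFrom f A) :
    LeavesFrom (fun x => e (f (e.symm x))) A := fun v => by
  obtain ⟨r, hr, hv⟩ := h (e.symm v)
  exact ⟨e r, by rwa [he], by simpa using hv.conj e fun x hx => (he x).2 hx⟩

theorem insert_iff [DecidableEq V] (hr : r ∉ A) :
    LeavesFrom f (insert r A) ↔ LeavesFrom f A ∧ ¬ ExitsAt f A r (f r) := by
  constructor
  · intro h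
    constructor
    · intro v
      obtain ⟨s, hs, hv⟩ := h v
      induction hv with
      | base => exact ⟨s, fun h => hs (Finset.mem_insert_of_mem h), .base⟩
      | step hv _ ih =>
        rcases Finset.mem_insert.1 hv with rfl | hv
        · exact ⟨_, hr, .base⟩
        · obtain ⟨t, ht, h⟩ := ih
          exact ⟨t, ht, .step hv h⟩
    · intro hc
      obtain ⟨s, hs, hv⟩ := h (f r)
      revert hc
      have key : ∀ v, ExitsAt f (insert r A) s v → ExitsAt f A r (f r) → ¬ ExitsAt f A r v := by
        intro v hv hc
        induction hv with
        | base =>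
          intro h
          exact hs (Finset.mem_insert.2 (or_iff_not_imp_right.2 fun h' => h.eq_of_notMem h'))
        | step hv _ ih =>
          intro h
          rcases Finset.mem_insert.1 hv with rfl | hv
          · exact ih hc
          · exact ih (h.of_mem hr hv)
      exact fun hc => key _ hv hc hc
  · rintro ⟨h, hc⟩ v
    obtain ⟨s, hs, hrs⟩ := h (f r)
    have hsr : s ≠ r := by
      rintro rfl
      exact hc hrs
    obtain ⟨t, ht, hv⟩ := h v
    have hsub := Finset.subset_insert r A
    by_cases htr : t = r
    · subst htr
      refine ⟨s, by simp [hs, hsr], ?_⟩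
      clear ht
      induction hv with
      | base => exact .step (Finset.mem_insert_self _ _) (hrs.mono hsub)
      | step hv _ ih => exact .step (hsub hv) ih
    · exact ⟨t, by simp [ht, htr], hv.mono hsub⟩

end LeavesFrom

theorem leavesFrom_iff_no_cycle [Finite V] :
    LeavesFrom f A ↔
      ¬ ∃ m : ℕ, 1 ≤ m ∧ ∃ a : ℕ → A, ∀ i < m, f (a i) = ↑(a ((i + 1) % m)) := by
  constructor
  · rintro h ⟨m, hm, a, ha⟩
    obtain ⟨r, hr, h0⟩ := h (a 0)
    have key : ∀ v, ExitsAt f A r v → ∀ i < m, v ≠ a i := by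
      intro v hv
      induction hv with
      | base =>
        rintro i - rfl
        exact hr (a i).2
      | step _ _ ih =>
        rintro i hi rfl
        exact ih _ (Nat.mod_lt _ hm) (ha i hi)
    exact key _ h0 0 hm rfl
  · intro h
    by_contra hl
    simp only [LeavesFrom, not_forall] at hl
    obtain ⟨v, hv⟩ := hl
    have hstay : ∀ i, ¬ ∃ r, r ∉ A ∧ ExitsAt f A r (f^[i] v) := by
      intro i
      induction i with
      | zero => exact hv
      | succ i ih =>
        rintro ⟨r, hr, hx⟩
        rw [Function.iterate_succ_apply'] at hx
        by_cases hi : f^[i] v ∈ A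
        · exact ih ⟨r, hr, .step hi hx⟩
        · exact ih ⟨_, hi, .base⟩
    have hmem : ∀ i, f^[i] v ∈ A := fun i => by
      by_contra hi
      exact hstay i ⟨_, hi, .base⟩
    obtain ⟨i, j, hij, he⟩ : ∃ i j, i < j ∧ f^[i] v = f^[j] v := by
      obtain ⟨i, j, hne, he⟩ := Finite.exists_ne_map_eq_of_infinite fun i : ℕ => f^[i] v
      rcases lt_or_gt_of_ne hne with h | h
      · exact ⟨i, j, h, he⟩
      · exact ⟨j, i, h, he.symm⟩
    refine h ⟨j - i, by omega, fun t => ⟨f^[i + t] v, hmem _⟩, fun t ht => ?_⟩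
    simp only [← Function.iterate_succ_apply' f]
    rcases Nat.lt_or_ge (t + 1) (j - i) with h1 | h1
    · rw [Nat.mod_eq_of_lt h1]
      rfl
    · have h2 : t + 1 = j - i := by omega
      rw [h2, Nat.mod_self, Nat.add_zero, he]
      congr 2
      omega

open Classical in
theorem card_exitsAt_le [Fintype V] [DecidableEq V] (hr : r ∉ A) (hs : s ∉ A) :
    (Finset.univ.filter fun f : V → V => LeavesFrom f A ∧ ExitsAt f A r (f r)).card ≤
      (Finset.univ.filter fun f : V → V => LeavesFrom f A ∧ ExitsAt f A s (f s)).card := by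
  have he : ∀ x, Equiv.swap r s x ∈ A ↔ x ∈ A := by
    intro x
    rw [Equiv.swap_apply_def]
    split_ifs with h1 h2
    · simp [h1, hr, hs]
    · simp [h2, hr, hs]
    · rfl
  refine Finset.card_le_card_of_injOn
    (fun f x => Equiv.swap r s (f ((Equiv.swap r s).symm x))) ?_ ?_
  · intro f hf
    simp only [Finset.coe_filter, Finset.mem_univ, true_and, Set.mem_ofPred_eq] at hf ⊢
    refine ⟨hf.1.conj _ he, ?_⟩
    simpa using hf.2.conj (Equiv.swap r s) fun x hx => (he x).2 hx
  · intro f _ g _ h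
    funext x
    simpa using congrFun h (Equiv.swap r s x)

open Classical in
theorem card_pairs_exitsAt [Fintype V] [DecidableEq V] (hr : r ∉ A) :
    (Finset.univ.filter fun p : (V → V) × V => LeavesFrom p.1 A ∧ ExitsAt p.1 A r p.2).card =
      (Finset.univ.filter fun f : V → V => LeavesFrom f A ∧ ExitsAt f A r (f r)).card *
        Fintype.card V := by
  rw [← Finset.card_univ, ← Finset.card_product]
  have hu : ∀ (f : V → V) (v : V), ∀ x ∈ A, f x = Function.update f r v x := by
    intro f v x hx
    rw [Function.update_of_ne]
    rintro rfl
    exact hr hx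
  refine Finset.card_bij' (fun p _ => (Function.update p.1 r p.2, p.1 r))
    (fun p _ => (Function.update p.1 r p.2, p.1 r)) ?_ ?_ ?_ ?_
  · rintro ⟨f, v⟩ h
    simp only [Finset.mem_filter, Finset.mem_univ, true_and] at h
    simp only [Finset.mem_product, Finset.mem_filter, Finset.mem_univ, true_and, and_true,
      Function.update_self]
    exact ⟨h.1.congr (hu f v), h.2.congr (hu f v)⟩
  · rintro ⟨f, v⟩ h
    simp only [Finset.mem_product, Finset.mem_filter, Finset.mem_univ, true_and, and_true] at h
    simp only [Finset.mem_filter, Finset.mem_univ, true_and]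
    exact ⟨h.1.congr (hu f v), h.2.congr (hu f v)⟩
  · rintro ⟨f, v⟩ _
    simp
  · rintro ⟨f, v⟩ _
    simp

open Classical in
theorem sum_card_exitsAt [Fintype V] [DecidableEq V] [Nonempty V] (A : Finset V) :
    ∑ r ∈ Aᶜ, (Finset.univ.filter fun f : V → V => LeavesFrom f A ∧ ExitsAt f A r (f r)).card =
      (Finset.univ.filter fun f : V → V => LeavesFrom f A).card := by
  refine Nat.eq_of_mul_eq_mul_right (Fintype.card_pos (α := V)) ?_
  rw [Finset.sum_mul, ← Finset.sum_congr rfl fun r hr =>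
    card_pairs_exitsAt (Finset.mem_compl.1 hr), ← Finset.card_biUnion]
  · rw [← Finset.card_univ, ← Finset.card_product]
    congr 1
    ext ⟨f, v⟩
    simp only [Finset.mem_biUnion, Finset.mem_compl, Finset.mem_filter, Finset.mem_univ,
      true_and, Finset.mem_product, and_true]
    constructor
    · rintro ⟨r, _, h, _⟩
      exact h
    · intro h
      obtain ⟨r, hr, hv⟩ := h v
      exact ⟨r, hr, h, hv⟩
  · intro r hr s hs hne
    rw [Function.onFun, Finset.disjoint_left]
    rintro ⟨f, v⟩ h1 h2
    simp only [Finset.mem_filter, Finset.mem_univ, true_and] at h1 h2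
    simp only [Finset.coe_compl, Set.mem_compl_iff, Finset.mem_coe] at hr hs
    exact hne (h1.2.unique hr hs h2.2)

open Classical in
theorem card_leavesFrom [Fintype V] [DecidableEq V] [Nonempty V] (A : Finset V) :
    (Finset.univ.filter fun f : V → V => LeavesFrom f A).card =
      (Fintype.card V - A.card) * Fintype.card V ^ (Fintype.card V - 1) := by
  induction A using Finset.induction_on with
  | empty =>
    have h : ∀ f : V → V, LeavesFrom f ∅ := fun f v => ⟨v, Finset.notMem_empty v, .base⟩
    rw [Finset.filter_true_of_mem fun f _ => h f, Finset.card_univ, Fintype.card_fun,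
      Finset.card_empty, Nat.sub_zero, mul_pow_sub_one Fintype.card_ne_zero]
  | insert r A hr ih =>
    have hsum := sum_card_exitsAt A
    rw [Finset.sum_congr rfl fun s hs => le_antisymm (card_exitsAt_le (Finset.mem_compl.1 hs) hr)
      (card_exitsAt_le hr (Finset.mem_compl.1 hs)), Finset.sum_const, smul_eq_mul,
      Finset.card_compl, ih] at hsum
    have hlt : A.card < Fintype.card V := by
      rw [← Finset.card_univ]
      exact Finset.card_lt_card (Finset.ssubset_univ_iff.2 fun h => hr (h ▸ Finset.mem_univ r))
    have hP := Nat.eq_of_mul_eq_mul_left (Nat.sub_pos_of_lt hlt) hsum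
    have hsplit := Finset.card_filter_add_card_filter_not
      (s := Finset.univ.filter fun f : V → V => LeavesFrom f A) fun f => ExitsAt f A r (f r)
    simp only [Finset.filter_filter, ← LeavesFrom.insert_iff hr] at hsplit
    rw [hP, ih] at hsplit
    rw [Finset.card_insert_of_notMem hr, Nat.sub_add_eq, Nat.sub_mul, one_mul]
    omega

end

/-- For a finite set `V` with `n` elements and a subset `A` with `k ≥ 1`
elements, the number of functions `g : A → V` that admit no directed cycle
(no `m ≥ 1` and `a 0, …, a (m-1)` in `A` with `g (a i) = a ((i+1) % m)` for
all `i < m`) equals `(n - k) * n ^ (k - 1)`. -/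
theorem count_acyclic_functions (V : Type*) [Fintype V] [DecidableEq V] (n k : ℕ)
    (hV : Fintype.card V = n) (A : Finset V) (hA : A.card = k) (hk : 1 ≤ k) :
    Nat.card {g : A → V //
        ¬ ∃ m : ℕ, 1 ≤ m ∧ ∃ a : ℕ → A, ∀ i < m, g (a i) = ↑(a ((i + 1) % m))} =
      (n - k) * n ^ (k - 1) := by
  classical
  have hkn : k ≤ n := by
    rw [← hA, ← hV]
    exact Finset.card_le_univ A
  have : Nonempty V := Fintype.card_pos_iff.1 (by omega)
  let P : (A → V) → Prop := fun g =>
    ¬ ∃ m : ℕ, 1 ≤ m ∧ ∃ a : ℕ → A, ∀ i < m, g (a i) = ↑(a ((i + 1) % m))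
  let e : (V → V) ≃ (A → V) × ({x // x ∉ A} → V) :=
    Equiv.piEquivPiSubtypeProd (fun x => x ∈ A) fun _ => V
  have e1 : {f : V → V // LeavesFrom f A} ≃ {g : A → V // P g} × ({x // x ∉ A} → V) :=
    (e.subtypeEquiv (q := fun p => P p.1) fun _ => leavesFrom_iff_no_cycle).trans
      Equiv.prodSubtypeFstEquivSubtypeProd
  have hcard := Nat.card_congr e1
  rw [Nat.card_prod, Nat.card_eq_fintype_card, Fintype.card_subtype, card_leavesFrom, hV, hA,
    Nat.card_eq_fintype_card (α := {x // x ∉ A} → V), Fintype.card_fun,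
    Fintype.card_subtype_compl, Fintype.card_coe, hV, hA] at hcard
  have hn : 0 < n ^ (n - k) := Nat.pow_pos (by omega)
  refine Nat.eq_of_mul_eq_mul_right hn (hcard.symm.trans ?_)
  rw [mul_assoc, ← pow_add]
  congr 2
  omega
end

section
/- For every n ≥ 2, the number of functions f : Fin (n-1) → Fin n that contain no directed cycle — i.e., for which there is no sequence v_0, ..., v_{m-1} of elements of Fin (n-1) (m ≥ 1) with f(v_i) = v_{(i+1) mod m} (as elements of Fin n, under the natural embedding of Fin (n-1) into Fin n) for all i — equals n^(n-2). -/
namespace PartialFunction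

open Function Matrix

variable {α : Type*}

lemma iterate_bind_none (f : α → Option α) (k : ℕ) :
    (fun o : Option α => o.bind f)^[k] none = none :=
  iterate_fixed rfl k

lemma iterate_bind_eq_none_of_le {f : α → Option α} {o : Option α} {k l : ℕ} (hkl : k ≤ l)
    (h : (fun o : Option α => o.bind f)^[k] o = none) :
    (fun o : Option α => o.bind f)^[l] o = none := by
  rw [← Nat.sub_add_cancel hkl, iterate_add_apply, h, iterate_bind_none]

/-- A partial function on `α` is cyclic if some element of `α` returns to itself. -/
def IsCyclic (f : α → Option α) : Prop :=
  ∃ i : α, some i ∈ periodicPts (fun o : Option α => o.bind f)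

lemma iterate_bind_ne_none_of_mem_periodicPts {f : α → Option α} {i : α}
    (h : some i ∈ periodicPts (fun o : Option α => o.bind f)) (k : ℕ) :
    (fun o : Option α => o.bind f)^[k] (some i) ≠ none := by
  intro hk
  obtain ⟨m, hm, hi⟩ := h
  have := (hi.mul_const k).eq
  rw [iterate_bind_eq_none_of_le (Nat.le_mul_of_pos_left k hm) hk] at this
  simp at this

lemma exists_iterate_bind_eq_none [Finite α] {f : α → Option α} (h : ¬ IsCyclic f) :
    ∃ k, ∀ i, (fun o : Option α => o.bind f)^[k] (some i) = none := by
  cases nonempty_fintype α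
  have key (i : α) : ∃ k, (fun o : Option α => o.bind f)^[k] (some i) = none := by
    obtain ⟨m, n, hmn, he⟩ := Finite.exists_ne_map_eq_of_infinite
      fun k => (fun o : Option α => o.bind f)^[k] (some i)
    wlog hlt : m < n generalizing m n
    · exact this n m hmn.symm he.symm (by omega)
    refine ⟨m, ?_⟩
    by_contra hne
    obtain ⟨j, hj⟩ := Option.ne_none_iff_exists'.1 hne
    refine h ⟨j, n - m, Nat.sub_pos_of_lt hlt, ?_⟩
    rw [← hj, IsPeriodicPt, IsFixedPt, ← iterate_add_apply, Nat.sub_add_cancel hlt.le]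
    exact he.symm
  choose k hk using key
  exact ⟨∑ i, k i, fun i => iterate_bind_eq_none_of_le
    (Finset.single_le_sum (fun _ _ => Nat.zero_le _) (Finset.mem_univ i)) (hk i)⟩

lemma isCyclic_iff_exists_cycle (f : α → Option α) :
    IsCyclic f ↔ ∃ m : ℕ, 1 ≤ m ∧ ∃ v : ℕ → α, ∀ i < m, f (v i) = some (v ((i + 1) % m)) := by
  constructor
  · rintro ⟨i, hi⟩
    choose v hv using fun k =>
      Option.ne_none_iff_exists'.1 (iterate_bind_ne_none_of_mem_periodicPts hi k)
    obtain ⟨m, hm, hp⟩ := hi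
    refine ⟨m, hm, v, fun t _ => ?_⟩
    rw [← hv, hp.iterate_mod_apply, iterate_succ_apply', hv]
    rfl
  · rintro ⟨m, hm, v, hv⟩
    have key (t : ℕ) :
        (fun o : Option α => o.bind f)^[t] (some (v 0)) = some (v (t % m)) := by
      induction t with
      | zero => simp
      | succ t ih =>
        rw [iterate_succ_apply', ih, ← Nat.mod_add_mod]
        exact hv _ (Nat.mod_lt _ hm)
    exact ⟨v 0, m, hm, by simpa [IsPeriodicPt, IsFixedPt] using key m⟩

variable [DecidableEq α]

/-- The adjacency matrix of a partial function. -/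
def adjMatrix (f : α → Option α) : Matrix α α ℚ :=
  of fun i j => if f i = some j then 1 else 0

variable [Fintype α]

lemma adjMatrix_pow_apply (f : α → Option α) (k : ℕ) (i j : α) :
    (adjMatrix f ^ k) i j =
      if (fun o : Option α => o.bind f)^[k] (some i) = some j then 1 else 0 := by
  induction k generalizing i with
  | zero => simp [Matrix.one_apply]
  | succ k ih =>
    rw [pow_succ', Matrix.mul_apply, iterate_succ_apply]
    simp only [ih]
    cases h : f i with
    | none => simp [adjMatrix, h, iterate_bind_none]
    | some l =>
      simp only [adjMatrix, of_apply, h, Option.some_inj, ite_mul, one_mul, zero_mul,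
        Finset.sum_ite_eq, Finset.mem_univ, if_true, Option.bind_some]

lemma det_one_sub_adjMatrix_of_isCyclic {f : α → Option α} (h : IsCyclic f) :
    (1 - adjMatrix f).det = 0 := by
  classical
  obtain ⟨i, hi⟩ := h
  refine exists_mulVec_eq_zero_iff.1 ⟨fun i =>
    if ∀ k, (fun o : Option α => o.bind f)^[k] (some i) ≠ none then 1 else 0, fun h0 => ?_, ?_⟩
  · simpa [iterate_bind_ne_none_of_mem_periodicPts hi] using congrFun h0 i
  · ext j
    have hstep : (∀ k, (fun o : Option α => o.bind f)^[k] (some j) ≠ none) ↔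
        ∀ k, (fun o : Option α => o.bind f)^[k] (f j) ≠ none :=
      ⟨fun H k => H (k + 1), fun H k hk => H k <|
        show (fun o : Option α => o.bind f)^[k + 1] (some j) = none from
          iterate_bind_eq_none_of_le k.le_succ hk⟩
    rw [sub_mulVec, one_mulVec, Pi.sub_apply, Pi.zero_apply, sub_eq_zero, if_congr hstep rfl rfl]
    cases h : f j with
    | none => simp [adjMatrix, h, iterate_bind_none, mulVec, dotProduct]
    | some l => simp only [adjMatrix, mulVec, dotProduct, of_apply, h, Option.some_inj, ite_mul,
        one_mul, zero_mul, Finset.sum_ite_eq, Finset.mem_univ, if_true]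

lemma det_one_sub_adjMatrix_of_not_isCyclic {f : α → Option α} (h : ¬ IsCyclic f) :
    (1 - adjMatrix f).det = 1 := by
  obtain ⟨k, hk⟩ := exists_iterate_bind_eq_none h
  have hnil : IsNilpotent (adjMatrix f) := ⟨k, by ext i j; simp [adjMatrix_pow_apply, hk]⟩
  have hchar := (isNilpotent_charpoly_sub_pow_of_isNilpotent hnil).eq_zero
  simpa [eval_charpoly, sub_eq_zero] using congrArg (Polynomial.eval 1) hchar

lemma sum_det_one_sub_adjMatrix [Nonempty α] :
    ∑ f : α → Option α, (1 - adjMatrix f).det =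
      ((Fintype.card α + 1) ^ (Fintype.card α - 1) : ℚ) := by
  have hrows := (detRowAlternating (n := α) (R := ℚ)).toMultilinearMap.map_sum
    fun (i : α) (o : Option α) (j : α) => (1 : Matrix α α ℚ) i j - if o = some j then 1 else 0
  have hsum : (fun i : α => ∑ o : Option α, fun j : α =>
      (1 : Matrix α α ℚ) i j - if o = some j then 1 else 0) =
      scalar α (Fintype.card α + 1 : ℚ) - vecMulVec 1 1 := by
    funext i j
    rw [Finset.sum_apply]
    change _ = (diagonal fun _ => (Fintype.card α + 1 : ℚ)) i j - 1 * 1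
    simp [Matrix.one_apply, diagonal_apply]
  rw [hsum] at hrows
  refine hrows.symm.trans ?_
  change (scalar α (Fintype.card α + 1 : ℚ) - vecMulVec 1 1).det = _
  rw [← eval_charpoly, charpoly_vecMulVec]
  obtain ⟨c, hc⟩ := Nat.exists_eq_succ_of_ne_zero (Fintype.card_ne_zero (α := α))
  simp [hc, dotProduct]
  ring

/-- The number of acyclic partial functions on a finite type, in bijection with rooted forests. -/
theorem card_not_isCyclic [Nonempty α] :
    Nat.card {f : α → Option α // ¬ IsCyclic f} =
      (Fintype.card α + 1) ^ (Fintype.card α - 1) := by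
  classical
  have hdet (f : α → Option α) : (1 - adjMatrix f).det = if ¬ IsCyclic f then 1 else 0 := by
    by_cases h : IsCyclic f
    · simp [h, det_one_sub_adjMatrix_of_isCyclic h]
    · simp [h, det_one_sub_adjMatrix_of_not_isCyclic h]
  have hsum := sum_det_one_sub_adjMatrix (α := α)
  simp only [hdet, Finset.sum_boole] at hsum
  rw [Nat.card_eq_fintype_card, Fintype.card_subtype]
  exact_mod_cast hsum

end PartialFunction


/-- For `n ≥ 2`, the number of functions `f : Fin (n-1) → Fin n` with no
directed cycle (no `m ≥ 1` and `v 0, …, v (m-1)` in `Fin (n-1)` with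
`f (v i)` equal to the embedding of `v ((i+1) % m)` for all `i < m`)
equals `n ^ (n - 2)`. -/
theorem count_acyclic_functions_fin (n : ℕ) (hn : 2 ≤ n) :
    Nat.card {f : Fin (n - 1) → Fin n //
        ¬ ∃ m : ℕ, 1 ≤ m ∧ ∃ v : ℕ → Fin (n - 1),
          ∀ i < m, f (v i) = Fin.castLE (Nat.sub_le n 1) (v ((i + 1) % m))} =
      n ^ (n - 2) := by
  obtain ⟨n, rfl⟩ := Nat.exists_eq_add_of_le' hn
  have hcard := PartialFunction.card_not_isCyclic (α := Fin (n + 1))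
  rw [Fintype.card_fin] at hcard
  refine Eq.trans (Nat.card_congr ?_) hcard
  refine (Equiv.arrowCongr (Equiv.refl (Fin (n + 1))) finSuccEquivLast).subtypeEquiv fun f => ?_
  rw [PartialFunction.isCyclic_iff_exists_cycle, not_iff_not]
  refine exists_congr fun m => and_congr_right fun _ => exists_congr fun v =>
    forall₂_congr fun i _ => ?_
  change _ ↔ finSuccEquivLast (f (v i)) = _
  rw [← finSuccEquivLast_castSucc, finSuccEquivLast.apply_eq_iff_eq]
  rfl
end

section
/- For every n ≥ 2, there is a bijection between the set of cycle-free functions f : Fin (n-1) → Fin n (those admitting no sequence v_0, ..., v_{m-1} in Fin (n-1), m ≥ 1, with f(v_i) equal to the embedding of v_{(i+1) mod m} for all i) and the set of labeled trees on n vertices, i.e., the set {G : SimpleGraph (Fin n) | G.IsTree}. The bijection sends f to the undirected graph on Fin n whose edges are the pairs {v, f(v)} for v ∈ Fin (n-1). -/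
/-- A function `f : Fin (n-1) → Fin n` is cycle-free if there is no `m ≥ 1` and
no `v 0, …, v (m-1)` in `Fin (n-1)` with `f (v i)` equal to the embedding of
`v ((i+1) % m)` for all `i < m`. -/
def CycleFree {n : ℕ} (f : Fin (n - 1) → Fin n) : Prop :=
  ¬ ∃ m : ℕ, 1 ≤ m ∧ ∃ v : ℕ → Fin (n - 1),
      ∀ i < m, f (v i) = Fin.castLE (Nat.sub_le n 1) (v ((i + 1) % m))

namespace CycleFree

variable {n : ℕ} {f : Fin (n - 1) → Fin n}

theorem of_decreasing (d : Fin n → ℕ)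
    (hd : ∀ v, d (f v) < d (Fin.castLE (Nat.sub_le n 1) v)) : CycleFree f := by
  rintro ⟨m, hm, v, hv⟩
  obtain ⟨i, hi, hmin⟩ := Finset.exists_min_image (Finset.range m)
    (fun i => d (Fin.castLE (Nat.sub_le n 1) (v i))) ⟨0, Finset.mem_range.2 hm⟩
  have hlt := hd (v i)
  rw [hv i (Finset.mem_range.1 hi)] at hlt
  exact (hmin _ (Finset.mem_range.2 (Nat.mod_lt _ hm))).not_gt hlt

theorem apply_ne (hf : CycleFree f) (v : Fin (n - 1)) :
    f v ≠ Fin.castLE (Nat.sub_le n 1) v :=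
  fun h => hf ⟨1, le_rfl, fun _ => v, fun _ _ => h⟩

theorem no_two_cycle (hf : CycleFree f) {u v : Fin (n - 1)}
    (hu : f u = Fin.castLE (Nat.sub_le n 1) v) : f v ≠ Fin.castLE (Nat.sub_le n 1) u := by
  refine fun hv => hf ⟨2, one_le_two, fun i => if i = 0 then u else v, fun i hi => ?_⟩
  interval_cases i <;> simpa

theorem eq_empty_of_forall_exists (hf : CycleFree f) (S : Set (Fin (n - 1)))
    (hS : ∀ v ∈ S, ∃ w ∈ S, f v = Fin.castLE (Nat.sub_le n 1) w) : S = ∅ := by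
  by_contra hne
  obtain ⟨x, hx⟩ := Set.nonempty_iff_ne_empty.2 hne
  choose! h hmem heq using hS
  have hiter : ∀ k, h^[k] x ∈ S := fun k => by
    induction k with
    | zero => exact hx
    | succ k ih => rw [Function.iterate_succ_apply']; exact hmem _ ih
  obtain ⟨a, b, hab, hEq⟩ : ∃ a b, a < b ∧ h^[a] x = h^[b] x := by
    obtain ⟨a, b, hne, hEq⟩ := Finite.exists_ne_map_eq_of_infinite fun k : ℕ => h^[k] x
    rcases hne.lt_or_gt with hlt | hlt
    exacts [⟨a, b, hlt, hEq⟩, ⟨b, a, hlt, hEq.symm⟩]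
  refine hf ⟨b - a, by lia, fun i => h^[a + i] x, fun i hi => ?_⟩
  rw [heq _ (hiter _), ← Function.iterate_succ_apply' h]
  rcases (Nat.succ_le_of_lt hi).lt_or_eq with hlt | hlast
  · rw [Nat.mod_eq_of_lt hlt]; rfl
  · have h1 : (i + 1) % (b - a) = 0 := by rw [← hlast]; exact Nat.mod_self _
    have h2 : (a + i).succ = b := by lia
    rw [h1, h2, ← hEq]
    rfl

/-- Induction along a cycle-free function, starting from the last vertex. -/
theorem induction (hf : CycleFree f) {P : Fin n → Prop}
    (root : ∀ x : Fin n, (x : ℕ) = n - 1 → P x)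
    (step : ∀ v, P (f v) → P (Fin.castLE (Nat.sub_le n 1) v)) (x : Fin n) : P x := by
  have key (y : Fin n) (hy : ¬ P y) : ∃ w, ¬ P (Fin.castLE (Nat.sub_le n 1) w) ∧
      y = Fin.castLE (Nat.sub_le n 1) w := by
    have hlt : (y : ℕ) < n - 1 := by
      have := mt (root y) hy
      lia
    exact ⟨⟨y, hlt⟩, hy, rfl⟩
  by_contra hx
  obtain ⟨w, hw, -⟩ := key x hx
  have hempty := hf.eq_empty_of_forall_exists {v | ¬ P (Fin.castLE (Nat.sub_le n 1) v)}
    fun v hv => key (f v) (mt (step v) hv)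
  exact (Set.eq_empty_iff_forall_notMem.1 hempty) w hw

end CycleFree

/-- The graph on `Fin n` whose edges are the pairs `{v, f v}`. -/
def functionGraph {n : ℕ} (f : Fin (n - 1) → Fin n) : SimpleGraph (Fin n) :=
  SimpleGraph.fromEdgeSet {s | ∃ v : Fin (n - 1), s = s(Fin.castLE (Nat.sub_le n 1) v, f v)}

theorem CycleFree.adj_functionGraph {n : ℕ} {f : Fin (n - 1) → Fin n} (hf : CycleFree f)
    (v : Fin (n - 1)) : (functionGraph f).Adj (Fin.castLE (Nat.sub_le n 1) v) (f v) :=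
  (SimpleGraph.fromEdgeSet_adj _).2 ⟨⟨v, rfl⟩, (hf.apply_ne v).symm⟩

theorem CycleFree.isTree_functionGraph {n : ℕ} {f : Fin (n - 1) → Fin n} (hn : 0 < n)
    (hf : CycleFree f) : (functionGraph f).IsTree := by
  have hreach (x : Fin n) : (functionGraph f).Reachable x ⟨n - 1, by lia⟩ := by
    refine hf.induction (P := fun x => (functionGraph f).Reachable x ⟨n - 1, by lia⟩)
      (fun x hx => ?_) (fun v hv => (hf.adj_functionGraph v).reachable.trans hv) x
    rw [show x = ⟨n - 1, by lia⟩ from Fin.ext hx]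
  have hconn : (functionGraph f).Connected :=
    { preconnected := fun x y => (hreach x).trans (hreach y).symm
      nonempty := ⟨⟨n - 1, by lia⟩⟩ }
  refine SimpleGraph.isTree_iff_connected_and_card.2
    ⟨hconn, le_antisymm ?_ hconn.card_vert_le_card_edgeSet_add_one⟩
  have hsub : (functionGraph f).edgeSet ⊆
      Set.range fun v : Fin (n - 1) => s(Fin.castLE (Nat.sub_le n 1) v, f v) := by
    intro e he
    rw [functionGraph, SimpleGraph.edgeSet_fromEdgeSet] at he
    obtain ⟨v, rfl⟩ := he.1
    exact ⟨v, rfl⟩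
  have hcard := (Nat.card_mono (Set.finite_range _) hsub).trans (Finite.card_range_le _)
  rw [Nat.card_fin] at hcard ⊢
  lia

theorem CycleFree.eq_of_functionGraph_eq {n : ℕ} {f g : Fin (n - 1) → Fin n}
    (hf : CycleFree f) (h : functionGraph f = functionGraph g) : f = g := by
  have key (x : Fin n) : ∀ v, x = Fin.castLE (Nat.sub_le n 1) v → f v = g v := by
    refine hf.induction (P := fun x => ∀ v, x = Fin.castLE (Nat.sub_le n 1) v → f v = g v)
      (fun x hx v hv => ?_) (fun v ih w hw => ?_) x
    · have := congrArg Fin.val hv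
      rw [Fin.val_castLE] at this
      lia
    · obtain rfl : v = w := Fin.castLE_injective _ hw
      have hadj := hf.adj_functionGraph v
      rw [h, functionGraph, SimpleGraph.fromEdgeSet_adj] at hadj
      obtain ⟨⟨u, hu⟩, -⟩ := hadj
      rcases Sym2.eq_iff.1 hu with ⟨h1, h2⟩ | ⟨h1, h2⟩
      · obtain rfl : v = u := Fin.castLE_injective _ h1
        exact h2
      · exact absurd ((ih u h2).trans h1.symm) (hf.no_two_cycle h2)
  exact funext fun v => key _ v rfl

theorem SimpleGraph.Connected.exists_adj_dist_lt {V : Type*} {G : SimpleGraph V}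
    (hG : G.Connected) {v r : V} (hv : v ≠ r) : ∃ w, G.Adj v w ∧ G.dist w r < G.dist v r := by
  obtain ⟨p, hp⟩ := hG.exists_walk_length_eq_dist v r
  cases p with
  | nil => exact absurd rfl hv
  | cons hadj q =>
    refine ⟨_, hadj, ?_⟩
    have := SimpleGraph.dist_le q
    rw [SimpleGraph.Walk.length_cons] at hp
    lia

theorem SimpleGraph.IsTree.exists_functionGraph_eq {n : ℕ} {G : SimpleGraph (Fin n)}
    (hn : 0 < n) (hG : G.IsTree) :
    ∃ f : Fin (n - 1) → Fin n, CycleFree f ∧ functionGraph f = G := by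
  have hne (v : Fin (n - 1)) : Fin.castLE (Nat.sub_le n 1) v ≠ ⟨n - 1, by lia⟩ :=
    fun h => v.2.ne (congrArg Fin.val h)
  choose f hadj hlt using fun v => hG.connected.exists_adj_dist_lt (hne v)
  have hf : CycleFree f := CycleFree.of_decreasing (fun x => G.dist x ⟨n - 1, by lia⟩) hlt
  have hle : functionGraph f ≤ G := by
    rw [functionGraph, SimpleGraph.fromEdgeSet_le]
    rintro _ ⟨⟨v, rfl⟩, -⟩
    exact hadj v
  exact ⟨f, hf, (SimpleGraph.isTree_iff_minimal_connected.1 hG).eq_of_le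
    (hf.isTree_functionGraph hn).connected hle⟩

/-- For `n ≥ 2`, sending a cycle-free `f : Fin (n-1) → Fin n` to the undirected
graph on `Fin n` with edges `{v, f v}` for `v : Fin (n-1)` is a bijection onto
the labeled trees on `n` vertices. -/
theorem acyclic_functions_equiv_trees (n : ℕ) (hn : 2 ≤ n) :
    ∃ e : {f : Fin (n - 1) → Fin n // CycleFree f} ≃ {G : SimpleGraph (Fin n) // G.IsTree},
      ∀ f : {f : Fin (n - 1) → Fin n // CycleFree f},
        (e f : SimpleGraph (Fin n)) = SimpleGraph.fromEdgeSet
          {s | ∃ v : Fin (n - 1), s = s(Fin.castLE (Nat.sub_le n 1) v, f.1 v)} := by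
  refine ⟨Equiv.ofBijective
    (fun f => ⟨functionGraph f.1, f.2.isTree_functionGraph (by lia)⟩) ⟨fun f g h => ?_, fun G => ?_⟩,
    fun f => rfl⟩
  · exact Subtype.ext (f.2.eq_of_functionGraph_eq (congrArg Subtype.val h))
  · obtain ⟨f, hf, hfG⟩ := G.2.exists_functionGraph_eq (by lia)
    exact ⟨⟨f, hf⟩, Subtype.ext hfG⟩
end
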